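/- arXiv:1710.01160 — 6 statements merged into one kernel-verified Lean document; each statement's English description precedes it below -/
import Mathlib

section
/- Let n ≥ 3 and let V ∈ B_q(ℝⁿ) for some q > n/2, with V not identically zero. Then there exist a constant C > 0 and a constant k₀ ≥ 1 such that for all x, y ∈ ℝⁿ: C⁻¹ ρ(x) (1 + |x−y|/ρ(x))^{−k₀} ≤ ρ(y) ≤ C ρ(x) (1 + |x−y|/ρ(x))^{k₀/(k₀+1)}. In particular, ρ(x) and ρ(y) are comparable (with constants independent of x, y) whenever |x−y| ≤ c ρ(x) for a fixed c > 0. -/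
open MeasureTheory Metric Set
open RealInnerProductSpace

noncomputable section

abbrev En (n : ℕ) := EuclideanSpace ℝ (Fin n)

/-- Reverse Hölder inequality with constant `C`. -/
def ReverseHolderWith (m : ℕ) (q : ℝ) (W : En m → ℝ) (C : ℝ) : Prop :=
  (∀ x, 0 ≤ W x) ∧ LocallyIntegrable W volume ∧
  LocallyIntegrable (fun y => W y ^ q) volume ∧
  ∀ (x : En m) (r : ℝ), 0 < r →
    ((volume (ball x r)).toReal⁻¹ * ∫ y in ball x r, W y ^ q) ^ q⁻¹
      ≤ C * ((volume (ball x r)).toReal⁻¹ * ∫ y in ball x r, W y)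

/-- The reverse Hölder class `B_q`. -/
def ReverseHolder (m : ℕ) (q : ℝ) (W : En m → ℝ) : Prop :=
  ∃ C : ℝ, 0 < C ∧ ReverseHolderWith m q W C

/-- The critical radius function `ρ`. -/
def criticalRadius (m : ℕ) (V : En m → ℝ) (x : En m) : ℝ :=
  sSup {r : ℝ | 0 < r ∧ r ^ ((2 : ℝ) - m) * ∫ y in ball x r, V y ≤ 1}

/-- Weak solution of `∂ₜ u − Δu + V u = 0` on the region `S`. -/
def IsCaloricOn (n : ℕ) (V : En n → ℝ) (u : En n → ℝ → ℝ) (S : Set (En n × ℝ)) : Prop :=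
  ∀ ψ : En n → ℝ → ℝ,
    ContDiff ℝ 1 (fun p : En n × ℝ => ψ p.1 p.2) →
    HasCompactSupport (fun p : En n × ℝ => ψ p.1 p.2) →
    tsupport (fun p : En n × ℝ => ψ p.1 p.2) ⊆ S →
    ((∫ p : En n × ℝ, ⟪gradient (fun y => u y p.2) p.1, gradient (fun y => ψ y p.2) p.1⟫)
      - ∫ p : En n × ℝ, u p.1 p.2 * deriv (ψ p.1) p.2)
      + ∫ p : En n × ℝ, V p.1 * u p.1 p.2 * ψ p.1 p.2 = 0

/-- `TMOBound n u M` : the TMO (Carleson-type) condition `‖u‖_{TMO} ≤ M`. -/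
def TMOBound (n : ℕ) (u : En n → ℝ → ℝ) (M : ℝ) : Prop :=
  ∀ (x : En n) (r : ℝ), 0 < r →
    (∫ t in Set.Ioc (0 : ℝ) (r ^ 2), ∫ y in ball x r,
        (‖gradient (fun z => u z t) y‖ ^ 2 + (deriv (u y) t) ^ 2))
      ≤ M ^ 2 * r ^ n

theorem volume_real_ball_En {n : ℕ} (x : En n) {r : ℝ} (hr : 0 < r) :
    volume.real (ball x r) = r ^ n * volume.real (ball (0 : En n) 1) := by
  rw [measureReal_def, Measure.addHaar_ball_of_pos _ _ hr, ENNReal.toReal_mul,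
    ENNReal.toReal_ofReal (by positivity), finrank_euclideanSpace_fin, measureReal_def]

theorem volume_real_ball_En_pos {n : ℕ} (x : En n) {r : ℝ} (hr : 0 < r) :
    0 < volume.real (ball x r) :=
  ENNReal.toReal_pos (measure_ball_pos _ _ hr).ne' measure_ball_lt_top.ne

theorem volume_real_ball_En_div {n : ℕ} (x : En n) {r R : ℝ} (hr : 0 < r) (hR : 0 < R) :
    volume.real (ball x r) / volume.real (ball x R) = (r / R) ^ n := by
  have := volume_real_ball_En_pos (0 : En n) one_pos
  rw [volume_real_ball_En x hr, volume_real_ball_En x hR, div_pow]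
  field_simp

theorem ReverseHolderWith.integrableOn_ball {n : ℕ} {q C : ℝ} {V : En n → ℝ}
    (h : ReverseHolderWith n q V C) (x : En n) (r : ℝ) : IntegrableOn V (ball x r) :=
  (h.2.1.integrableOn_isCompact (isCompact_closedBall x r)).mono_set ball_subset_closedBall

theorem ReverseHolderWith.setIntegral_ball_mono {n : ℕ} {q C : ℝ} {V : En n → ℝ}
    (h : ReverseHolderWith n q V C) {x y : En n} {r s : ℝ} (hsub : ball x r ⊆ ball y s) :
    ∫ z in ball x r, V z ≤ ∫ z in ball y s, V z :=
  setIntegral_mono_set (h.integrableOn_ball y s) (Filter.Eventually.of_forall h.1)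
    hsub.eventuallyLE

theorem ReverseHolderWith.setIntegral_ball_nonneg {n : ℕ} {q C : ℝ} {V : En n → ℝ}
    (h : ReverseHolderWith n q V C) (x : En n) (r : ℝ) : 0 ≤ ∫ z in ball x r, V z :=
  integral_nonneg h.1

/-- Under a reverse Hölder inequality, the `V`-mass of a subset of a ball is controlled by a power
of its relative Lebesgue measure. -/
theorem ReverseHolderWith.setIntegral_le {n : ℕ} {q C : ℝ} {V : En n → ℝ} (hq : 1 < q)
    (h : ReverseHolderWith n q V C) (x : En n) {R : ℝ} (hR : 0 < R) {E : Set (En n)}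
    (hE : E ⊆ ball x R) :
    ∫ y in E, V y ≤ C * (volume.real E / volume.real (ball x R)) ^ (1 - q⁻¹) *
      ∫ y in ball x R, V y := by
  have hb := volume_real_ball_En_pos x hR
  have hB1 := h.integrableOn_ball x R
  obtain ⟨hV0, -, hVq, hrev⟩ := h
  have hEfin : volume E ≠ ⊤ := (measure_mono hE).trans_lt measure_ball_lt_top |>.ne
  have : IsFiniteMeasure (volume.restrict E) := ⟨by simpa using hEfin.lt_top⟩
  have hBq : IntegrableOn (fun y => V y ^ q) (ball x R) :=
    (hVq.integrableOn_isCompact (isCompact_closedBall x R)).mono_set ball_subset_closedBall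
  have hpq : (Real.conjExponent q).HolderConjugate q := (Real.HolderConjugate.conjExponent hq).symm
  have hq0 : 0 < q := by linarith
  have hmem : MemLp V (ENNReal.ofReal q) (volume.restrict E) := by
    rw [← integrable_norm_rpow_iff (hB1.mono_set hE).aestronglyMeasurable
      (by simpa using hq0) ENNReal.ofReal_ne_top, ENNReal.toReal_ofReal hq0.le]
    refine (hBq.mono_set hE).congr (Filter.Eventually.of_forall fun y => ?_)
    simp [abs_of_nonneg (hV0 y)]
  have hH := integral_mul_le_Lp_mul_Lq_of_nonneg (μ := volume.restrict E) hpq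
    (f := fun _ => (1 : ℝ)) (g := V) (Filter.Eventually.of_forall fun _ => zero_le_one)
    (Filter.Eventually.of_forall hV0) (memLp_const 1) hmem
  have hp : 1 / Real.conjExponent q = 1 - q⁻¹ := by
    rw [one_div]; linarith [hpq.inv_add_inv_eq_one]
  simp only [one_mul, Real.one_rpow, integral_const, smul_eq_mul, mul_one, hp, one_div,
    measureReal_restrict_apply_univ] at hH
  have hr := hrev x R hR
  change ((volume.real (ball x R))⁻¹ * _) ^ q⁻¹ ≤ C * ((volume.real (ball x R))⁻¹ * _) at hr
  set b := volume.real (ball x R)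
  set e := volume.real E
  have he : 0 ≤ e := measureReal_nonneg
  have hmono : ∫ y in E, V y ^ q ≤ ∫ y in ball x R, V y ^ q :=
    setIntegral_mono_set hBq (Filter.Eventually.of_forall fun y => Real.rpow_nonneg (hV0 y) q)
      hE.eventuallyLE
  have hI0 : 0 ≤ ∫ y in E, V y ^ q := integral_nonneg fun y => Real.rpow_nonneg (hV0 y) q
  rw [Real.mul_rpow (by positivity) (hI0.trans hmono), Real.inv_rpow hb.le] at hr
  have hr' : (∫ y in ball x R, V y ^ q) ^ q⁻¹ ≤
      b ^ q⁻¹ * (C * (b⁻¹ * ∫ y in ball x R, V y)) := by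
    rwa [← inv_mul_le_iff₀ (by positivity)]
  calc ∫ y in E, V y ≤ e ^ (1 - q⁻¹) * (∫ y in E, V y ^ q) ^ q⁻¹ := hH
    _ ≤ e ^ (1 - q⁻¹) * (b ^ q⁻¹ * (C * (b⁻¹ * ∫ y in ball x R, V y))) := by
        gcongr
        exact (Real.rpow_le_rpow hI0 hmono (by positivity)).trans hr'
    _ = _ := by
        rw [Real.div_rpow he hb.le, Real.rpow_sub hb, Real.rpow_one]
        field_simp

/-- Power growth of the mass of concentric balls; in particular `V` is doubling. -/
theorem ReverseHolderWith.exists_setIntegral_ball_mul_le {n : ℕ} {q C : ℝ} {V : En n → ℝ}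
    (hq : 1 < q) (h : ReverseHolderWith n q V C) :
    ∃ κ : ℝ, 0 < κ ∧ ∀ (x : En n) (r l : ℝ), 0 < r → 1 ≤ l →
      ∫ y in ball x (l * r), V y ≤ 2 * l ^ κ * ∫ y in ball x r, V y := by
  have hβ : 0 < 1 - q⁻¹ := sub_pos.2 (inv_lt_one_of_one_lt₀ hq)
  obtain ⟨t, ht0, ht1, ht⟩ : ∃ t : ℝ, 0 < t ∧ t < 1 ∧ C * (1 - t ^ n) ^ (1 - q⁻¹) < 1 / 2 := by
    have hcont : Continuous fun t : ℝ => C * (1 - t ^ n) ^ (1 - q⁻¹) :=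
      continuous_const.mul ((by fun_prop : Continuous fun t : ℝ => 1 - t ^ n).rpow_const
        fun _ => Or.inr hβ.le)
    have h1 : ∀ᶠ t in nhds (1 : ℝ), C * (1 - t ^ n) ^ (1 - q⁻¹) < 1 / 2 :=
      hcont.continuousAt.eventually_lt_const (by simp [Real.zero_rpow hβ.ne'])
    have h2 : ∀ᶠ t in nhdsWithin (1 : ℝ) (Iio 1), t ∈ Ioo (0 : ℝ) 1 :=
      Ioo_mem_nhdsLT one_pos
    obtain ⟨t, a, b⟩ := ((h1.filter_mono nhdsWithin_le_nhds).and h2).exists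
    exact ⟨t, b.1, b.2, a⟩
  have hstep : ∀ (x : En n) (R : ℝ), 0 < R →
      ∫ y in ball x R, V y ≤ 2 * ∫ y in ball x (t * R), V y := by
    intro x R hR
    have htR : 0 < t * R := by positivity
    have hsub : ball x (t * R) ⊆ ball x R := ball_subset_ball (by nlinarith)
    have hE := h.setIntegral_le hq x hR (E := ball x R \ ball x (t * R)) sdiff_subset
    rw [measureReal_sdiff hsub measurableSet_ball, sub_div,
      div_self (volume_real_ball_En_pos x hR).ne', volume_real_ball_En_div x htR hR,
      mul_div_cancel_right₀ _ hR.ne',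
      setIntegral_sdiff measurableSet_ball (h.integrableOn_ball x R) hsub] at hE
    have := mul_le_mul_of_nonneg_right ht.le (h.setIntegral_ball_nonneg x R)
    linarith
  have hb : 1 < t⁻¹ := (one_lt_inv₀ ht0).2 ht1
  have hiter : ∀ (x : En n) (r : ℝ), 0 < r → ∀ j : ℕ,
      ∫ y in ball x (t⁻¹ ^ j * r), V y ≤ 2 ^ j * ∫ y in ball x r, V y := by
    intro x r hr j
    induction j with
    | zero => simp
    | succ j ih =>
      have := hstep x (t⁻¹ ^ (j + 1) * r) (by positivity)
      rw [pow_succ', ← mul_assoc, ← mul_assoc, mul_inv_cancel₀ ht0.ne', one_mul] at this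
      rw [pow_succ' (2 : ℝ), pow_succ']
      linarith
  refine ⟨Real.logb t⁻¹ 2, Real.logb_pos hb one_lt_two, fun x r l hr hl => ?_⟩
  obtain ⟨j, hj, hj'⟩ := exists_nat_pow_near hl hb
  have hpow : ((t⁻¹ ^ j : ℝ)) ^ Real.logb t⁻¹ 2 = 2 ^ j := by
    rw [← Real.rpow_natCast, ← Real.rpow_mul (by positivity), mul_comm,
      Real.rpow_mul (by positivity), Real.rpow_logb (by positivity) hb.ne' two_pos,
      Real.rpow_natCast]
  have hk : (2 : ℝ) ^ j ≤ l ^ Real.logb t⁻¹ 2 := by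
    rw [← hpow]
    exact Real.rpow_le_rpow (by positivity) hj (Real.logb_pos hb one_lt_two).le
  calc ∫ y in ball x (l * r), V y
      ≤ ∫ y in ball x (t⁻¹ ^ (j + 1) * r), V y :=
        h.setIntegral_ball_mono (ball_subset_ball (by gcongr))
    _ ≤ 2 ^ (j + 1) * ∫ y in ball x r, V y := hiter x r hr _
    _ ≤ _ := by
        rw [pow_succ']
        have := h.setIntegral_ball_nonneg x r
        gcongr

theorem ReverseHolderWith.setIntegral_ball_pos {n : ℕ} {q C : ℝ} {V : En n → ℝ}
    (hq : 1 < q) (h : ReverseHolderWith n q V C) (hV0 : ¬ ∀ᵐ x ∂(volume : Measure (En n)), V x = 0)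
    (x : En n) {r : ℝ} (hr : 0 < r) : 0 < ∫ y in ball x r, V y := by
  by_contra hle
  have hzero := le_antisymm (not_lt.1 hle) (h.setIntegral_ball_nonneg x r)
  obtain ⟨κ, -, hκ⟩ := h.exists_setIntegral_ball_mul_le hq
  refine hV0 ?_
  have hball : ∀ k : ℕ, ∀ᵐ y, y ∈ ball x ((k + 1 : ℝ) * r) → V y = 0 := by
    intro k
    have h0 : ∫ y in ball x ((k + 1 : ℝ) * r), V y = 0 := by
      refine le_antisymm ?_ (h.setIntegral_ball_nonneg _ _)
      simpa [hzero] using hκ x r (k + 1) hr (by simp)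
    rw [setIntegral_eq_zero_iff_of_nonneg_ae (Filter.Eventually.of_forall h.1)
      (h.integrableOn_ball _ _)] at h0
    exact (ae_restrict_iff' measurableSet_ball).1 h0
  filter_upwards [ae_all_iff.2 hball] with y hy
  obtain ⟨k, hk⟩ := exists_nat_gt (dist y x / r)
  refine hy k (mem_ball.2 ?_)
  rw [div_lt_iff₀ hr] at hk
  nlinarith

/-- The quantity `r ^ (2 - n) * ∫_{B(x, r)} V` decays like a positive power of `r`. -/
theorem ReverseHolderWith.rpow_mul_setIntegral_ball_le {n : ℕ} {q C : ℝ} {V : En n → ℝ}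
    (hq : 1 < q) (h : ReverseHolderWith n q V C) (x : En n) {r R : ℝ} (hr : 0 < r) (hrR : r ≤ R) :
    r ^ ((2 : ℝ) - n) * ∫ y in ball x r, V y ≤
      C * (r / R) ^ (2 - n / q) * (R ^ ((2 : ℝ) - n) * ∫ y in ball x R, V y) := by
  have hR : 0 < R := hr.trans_le hrR
  have hA := h.setIntegral_le hq x hR (ball_subset_ball hrR)
  rw [volume_real_ball_En_div x hr hR] at hA
  calc _ ≤ r ^ ((2 : ℝ) - n) * (C * ((r / R) ^ n) ^ (1 - q⁻¹) * ∫ y in ball x R, V y) := by gcongr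
    _ = _ := by
        have hpow : r ^ ((2 : ℝ) - n) * ((r / R) ^ n) ^ (1 - q⁻¹) =
            (r / R) ^ (2 - n / q) * R ^ ((2 : ℝ) - n) := by
          have hrr : r ^ ((2 : ℝ) - n) = (r / R) ^ ((2 : ℝ) - n) * R ^ ((2 : ℝ) - n) := by
            rw [← Real.mul_rpow (by positivity) hR.le, div_mul_cancel₀ _ hR.ne']
          rw [← Real.rpow_natCast, ← Real.rpow_mul (by positivity), hrr, mul_right_comm,
            ← Real.rpow_add (by positivity)]
          congr 2
          ring
        linear_combination (C * ∫ y in ball x R, V y) * hpow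

/-- A positive function with power decay at scale zero has a finite positive critical radius. -/
theorem sSup_sublevel_of_power_decay {g : ℝ → ℝ} {C α : ℝ} (hC : 0 < C) (hα : 0 < α)
    (hpos : ∀ r, 0 < r → 0 < g r)
    (hg : ∀ r R, 0 < r → r ≤ R → g r ≤ C * (r / R) ^ α * g R) :
    BddAbove {r | 0 < r ∧ g r ≤ 1} ∧ 0 < sSup {r | 0 < r ∧ g r ≤ 1} ∧
      g (sSup {r | 0 < r ∧ g r ≤ 1} / 2) ≤ C := by
  have hbdd : BddAbove {r | 0 < r ∧ g r ≤ 1} := by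
    refine ⟨max 1 ((C / g 1) ^ α⁻¹), fun R ⟨hR, hgR⟩ => ?_⟩
    rcases le_total R 1 with h1 | h1
    · exact le_max_of_le_left h1
    refine le_max_of_le_right ?_
    have hg1 := hpos 1 one_pos
    rw [Real.le_rpow_inv_iff_of_pos hR.le (by positivity) hα, le_div_iff₀ hg1]
    have h2 := hg 1 R one_pos h1
    have hRα : 0 < R ^ α := by positivity
    rw [one_div, Real.inv_rpow hR.le] at h2
    calc R ^ α * g 1 ≤ R ^ α * (C * (R ^ α)⁻¹ * g R) := by gcongr
      _ = C * g R := by field_simp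
      _ ≤ C := mul_le_of_le_one_right hC.le hgR
  have hne : ∃ r, 0 < r ∧ g r ≤ 1 := by
    have hg1 := hpos 1 one_pos
    set s := ((C * g 1)⁻¹) ^ α⁻¹
    have hs : 0 < s := by positivity
    refine ⟨min 1 s, by positivity, (hg _ 1 (by positivity) (min_le_left _ _)).trans ?_⟩
    have h1 : (min 1 s / 1) ^ α ≤ (C * g 1)⁻¹ := by
      calc (min 1 s / 1) ^ α ≤ s ^ α := by
            rw [div_one]
            exact Real.rpow_le_rpow (by positivity) (min_le_right _ _) hα.le
        _ = _ := Real.rpow_inv_rpow (by positivity) hα.ne'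
    calc C * (min 1 s / 1) ^ α * g 1 ≤ C * (C * g 1)⁻¹ * g 1 := by gcongr
      _ = 1 := by field_simp
  have hρ : 0 < sSup {r | 0 < r ∧ g r ≤ 1} := by
    obtain ⟨r, hr⟩ := hne
    exact hr.1.trans_le (le_csSup hbdd hr)
  refine ⟨hbdd, hρ, ?_⟩
  obtain ⟨r, hr, hlt⟩ := exists_lt_of_lt_csSup hne (half_lt_self hρ)
  have hle : (sSup {r | 0 < r ∧ g r ≤ 1} / 2 / r) ^ α ≤ 1 :=
    Real.rpow_le_one (div_pos (half_pos hρ) hr.1).le ((div_le_one hr.1).2 hlt.le) hα.le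
  calc _ ≤ C * (sSup {r | 0 < r ∧ g r ≤ 1} / 2 / r) ^ α * g r := hg _ _ (half_pos hρ) hlt.le
    _ ≤ C * 1 * 1 := by
        have := (hpos r hr.1).le
        gcongr
        exact hr.2
    _ = C := by ring

/-- The lower bound for the critical radius, together with its positivity. -/
theorem ReverseHolder.exists_le_criticalRadius {n : ℕ} (hn : 3 ≤ n) {q : ℝ} (hq : (n : ℝ) / 2 < q)
    {V : En n → ℝ} (hV : ReverseHolder n q V)
    (hV0 : ¬ (∀ᵐ x ∂(volume : Measure (En n)), V x = 0)) :
    (∀ x, 0 < criticalRadius n V x) ∧ ∃ c : ℝ, 0 < c ∧ ∃ k : ℝ, 1 ≤ k ∧ ∀ x y : En n,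
      c * criticalRadius n V x * (1 + dist x y / criticalRadius n V x) ^ (-k) ≤
        criticalRadius n V y := by
  have hn' : (3 : ℝ) ≤ n := by exact_mod_cast hn
  have hq1 : 1 < q := by linarith
  obtain ⟨C₀, hC₀, h⟩ := hV
  set C := max 1 C₀
  have hC1 : 1 ≤ C := le_max_left _ _
  have hC : 0 < C := by positivity
  set α : ℝ := 2 - n / q with hαdef
  have hα : 0 < α := by
    rw [hαdef, sub_pos, div_lt_iff₀ (by linarith)]
    linarith
  set f : En n → ℝ → ℝ := fun x r => r ^ ((2 : ℝ) - n) * ∫ y in ball x r, V y with hf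
  have hfpos : ∀ x r, 0 < r → 0 < f x r := fun x r hr =>
    mul_pos (Real.rpow_pos_of_pos hr _) (h.setIntegral_ball_pos hq1 hV0 x hr)
  have hfdecay : ∀ x r R, 0 < r → r ≤ R → f x r ≤ C * (r / R) ^ α * f x R := by
    intro x r R hr hrR
    have hR := hr.trans_le hrR
    have := (hfpos x R hR).le
    refine (h.rpow_mul_setIntegral_ball_le hq1 x hr hrR).trans ?_
    change C₀ * (r / R) ^ α * f x R ≤ _
    gcongr
    exact le_max_right _ _
  have hcrit := fun x => sSup_sublevel_of_power_decay hC hα (hfpos x) (hfdecay x)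
  have hρpos : ∀ x, 0 < criticalRadius n V x := fun x => (hcrit x).2.1
  have hρle : ∀ x, f x (criticalRadius n V x / 2) ≤ C := fun x => (hcrit x).2.2
  have hleρ : ∀ x s, 0 < s → f x s ≤ 1 → s ≤ criticalRadius n V x := fun x s hs hfs =>
    le_csSup (hcrit x).1 ⟨hs, hfs⟩
  obtain ⟨κ, hκ, hgrow⟩ := h.exists_setIntegral_ball_mul_le hq1
  set K : ℝ := 2 * C ^ 2 * 4 ^ κ with hK
  have hK1 : 1 ≤ K := by
    have h4 : (1 : ℝ) ≤ 4 ^ κ := Real.one_le_rpow (by norm_num) hκ.le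
    have hC2 : 1 ≤ C ^ 2 := one_le_pow₀ hC1
    nlinarith
  have hK0 : 0 < K := by positivity
  refine ⟨hρpos, (K⁻¹) ^ α⁻¹, by positivity, max 1 (κ / α), le_max_left _ _, fun x y => ?_⟩
  set ρ := criticalRadius n V x
  have hρ : 0 < ρ := hρpos x
  set l : ℝ := 1 + dist x y / ρ with hl
  have hl1 : 1 ≤ l := by
    have : 0 ≤ dist x y / ρ := by positivity
    linarith
  have hl0 : 0 < l := by linarith
  have hRd : l * ρ = ρ + dist x y := by rw [hl]; field_simp
  set R := l * ρ
  have hR : 0 < R := by positivity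
  have hfy : f y R ≤ 2 * C * 4 ^ κ * l ^ κ := by
    have h1 : ∫ z in ball y R, V z ≤ 2 * (4 * l) ^ κ * ∫ z in ball x (ρ / 2), V z := by
      refine (h.setIntegral_ball_mono ?_).trans (hgrow x (ρ / 2) (4 * l) (by positivity)
        (by linarith))
      refine ball_subset_ball' ?_
      rw [dist_comm y x]
      have : 4 * l * (ρ / 2) = 2 * R := by ring
      linarith
    have h2 : R ^ ((2 : ℝ) - n) ≤ (ρ / 2) ^ ((2 : ℝ) - n) :=
      Real.rpow_le_rpow_of_nonpos (by positivity) (by linarith [dist_nonneg (x := x) (y := y)])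
        (by linarith)
    calc f y R ≤ (ρ / 2) ^ ((2 : ℝ) - n) * (2 * (4 * l) ^ κ * ∫ z in ball x (ρ / 2), V z) :=
          mul_le_mul h2 h1 (h.setIntegral_ball_nonneg _ _) (by positivity)
      _ = 2 * (4 * l) ^ κ * f x (ρ / 2) := by rw [hf]; ring
      _ ≤ 2 * (4 * l) ^ κ * C := by gcongr; exact hρle x
      _ = _ := by rw [Real.mul_rpow (by norm_num) hl0.le]; ring
  set s := (K⁻¹) ^ α⁻¹ * l ^ (-(κ / α)) * R with hs
  have hs0 : 0 < s := by positivity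
  have hsR : s ≤ R := by
    have h1 : (K⁻¹) ^ α⁻¹ ≤ 1 :=
      Real.rpow_le_one (by positivity) (inv_le_one_of_one_le₀ hK1) (by positivity)
    have h2 : l ^ (-(κ / α)) ≤ 1 :=
      Real.rpow_le_one_of_one_le_of_nonpos hl1 (neg_nonpos.2 (by positivity))
    exact mul_le_of_le_one_left hR.le (mul_le_one₀ h1 (by positivity) h2)
  have hsα : (s / R) ^ α = K⁻¹ * (l ^ κ)⁻¹ := by
    rw [hs, mul_div_cancel_right₀ _ hR.ne', Real.mul_rpow (by positivity) (by positivity),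
      Real.rpow_inv_rpow (by positivity) hα.ne', ← Real.rpow_mul hl0.le, ← Real.rpow_neg hl0.le]
    congr 2
    field_simp
  have hfs : f y s ≤ 1 := by
    have hlκ : 0 < l ^ κ := by positivity
    calc f y s ≤ C * (s / R) ^ α * f y R := hfdecay y s R hs0 hsR
      _ ≤ C * (s / R) ^ α * (2 * C * 4 ^ κ * l ^ κ) := by gcongr
      _ = K * K⁻¹ * (l ^ κ * (l ^ κ)⁻¹) := by rw [hsα, hK]; ring
      _ = 1 := by rw [mul_inv_cancel₀ hK0.ne', mul_inv_cancel₀ hlκ.ne', one_mul]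
  refine le_trans ?_ (hleρ y s hs0 hfs)
  have hpow : l ^ (-max 1 (κ / α)) ≤ l ^ (-(κ / α)) :=
    Real.rpow_le_rpow_of_exponent_le hl1 (neg_le_neg (le_max_right _ _))
  have hρR : ρ ≤ R := le_mul_of_one_le_left hρ.le hl1
  calc (K⁻¹) ^ α⁻¹ * ρ * l ^ (-max 1 (κ / α)) ≤ (K⁻¹) ^ α⁻¹ * R * l ^ (-(κ / α)) := by gcongr
    _ = s := by rw [hs]; ring

/-- Reversing a lower power bound between two positive scales at distance `d`. -/
theorem le_mul_one_add_div_rpow_of_lower_bound {a b c d k : ℝ} (ha : 0 < a) (hb : 0 < b)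
    (hc : 0 < c) (hc1 : c ≤ 1) (hd : 0 ≤ d) (hk : 0 < k)
    (h : c * b * (1 + d / b) ^ (-k) ≤ a) :
    b ≤ c⁻¹ * 2 ^ k * a * (1 + d / a) ^ (k / (k + 1)) := by
  have hk1 : 0 < k + 1 := by linarith
  have hX : 1 ≤ 1 + d / a := le_add_of_nonneg_right (by positivity)
  have hcb : c * b ≤ a * (1 + d / b) ^ k := by
    rwa [Real.rpow_neg (by positivity), ← div_eq_mul_inv, div_le_iff₀ (by positivity)] at h
  have h2k : (1 : ℝ) ≤ 2 ^ k := Real.one_le_rpow one_le_two hk.le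
  have hc' : 1 ≤ c⁻¹ := (one_le_inv₀ hc).2 hc1
  rcases le_total d b with hdb | hbd
  · have h1 : (1 + d / b) ^ k ≤ 2 ^ k :=
      Real.rpow_le_rpow (by positivity) (by linarith [(div_le_one hb).2 hdb]) hk.le
    calc b = c⁻¹ * (c * b) := by field_simp
      _ ≤ c⁻¹ * (a * 2 ^ k) :=
        mul_le_mul_of_nonneg_left (hcb.trans (by gcongr)) (by positivity)
      _ = c⁻¹ * 2 ^ k * a * 1 := by ring
      _ ≤ _ := by gcongr; exact Real.one_le_rpow hX (by positivity)
  · have h1 : (1 + d / b) ^ k ≤ 2 ^ k * (1 + d / a) ^ k * (a / b) ^ k := by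
      rw [← Real.mul_rpow (by positivity) (by positivity),
        ← Real.mul_rpow (by positivity) (by positivity)]
      refine Real.rpow_le_rpow (by positivity) ?_ hk.le
      have : 2 * (1 + d / a) * (a / b) = 2 * (a / b) + 2 * (d / b) := by field_simp
      have h3 : 1 ≤ d / b := (one_le_div hb).2 hbd
      have h4 : 0 < a / b := by positivity
      linarith
    have h2 : (b / a) ^ (k + 1) ≤ c⁻¹ * 2 ^ k * (1 + d / a) ^ k := by
      rw [Real.rpow_add (by positivity), Real.rpow_one]
      have h3 : (b / a) ^ k * (a / b) ^ k = 1 := by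
        rw [← Real.mul_rpow (by positivity) (by positivity)]
        have : b / a * (a / b) = 1 := by field_simp
        rw [this, Real.one_rpow]
      calc (b / a) ^ k * (b / a) = (b / a) ^ k * (c⁻¹ * a⁻¹ * (c * b)) := by field_simp
        _ ≤ (b / a) ^ k * (c⁻¹ * a⁻¹ * (a * (2 ^ k * (1 + d / a) ^ k * (a / b) ^ k))) := by
            gcongr ?_ * (?_ * ?_)
            exact hcb.trans (by gcongr)
        _ = c⁻¹ * 2 ^ k * (1 + d / a) ^ k * ((b / a) ^ k * (a / b) ^ k) * (a⁻¹ * a) := by ring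
        _ = _ := by rw [h3, inv_mul_cancel₀ ha.ne']; ring
    have hM : 1 ≤ c⁻¹ * 2 ^ k := one_le_mul_of_one_le_of_one_le hc' h2k
    have h5 : b / a ≤ c⁻¹ * 2 ^ k * (1 + d / a) ^ (k / (k + 1)) := by
      refine (Real.rpow_le_rpow_iff (by positivity) (by positivity) hk1).1 (h2.trans ?_)
      rw [Real.mul_rpow (by positivity) (by positivity), ← Real.rpow_mul (by positivity),
        div_mul_cancel₀ _ hk1.ne']
      gcongr
      exact Real.self_le_rpow_of_one_le hM (by linarith)
    rw [div_le_iff₀ ha] at h5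
    linarith

/-- Lemma 2.1: two-sided comparability of the critical radius. -/
theorem statement0 (n : ℕ) (hn : 3 ≤ n) (q : ℝ) (hq : (n : ℝ) / 2 < q)
    (V : En n → ℝ) (hV : ReverseHolder n q V)
    (hV0 : ¬ (∀ᵐ x ∂(volume : Measure (En n)), V x = 0)) :
    (∃ C : ℝ, 0 < C ∧ ∃ k₀ : ℝ, 1 ≤ k₀ ∧ ∀ x y : En n,
        C⁻¹ * criticalRadius n V x *
            (1 + dist x y / criticalRadius n V x) ^ (-k₀) ≤ criticalRadius n V y ∧
        criticalRadius n V y ≤ C * criticalRadius n V x *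
            (1 + dist x y / criticalRadius n V x) ^ (k₀ / (k₀ + 1))) ∧
    (∀ c : ℝ, 0 < c → ∃ C' : ℝ, 0 < C' ∧ ∀ x y : En n,
        dist x y ≤ c * criticalRadius n V x →
        C'⁻¹ * criticalRadius n V x ≤ criticalRadius n V y ∧
        criticalRadius n V y ≤ C' * criticalRadius n V x) := by
  obtain ⟨hρ, c, hc, k, hk, hlow⟩ := hV.exists_le_criticalRadius hn hq hV0
  have hc1 : c ≤ 1 := by
    have := hlow 0 0
    rw [dist_self, zero_div, add_zero, Real.one_rpow, mul_one] at this
    exact le_of_mul_le_mul_right (this.trans_eq (one_mul _).symm) (hρ 0)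
  have hk0 : 0 < k := by linarith
  have hup := fun x y => le_mul_one_add_div_rpow_of_lower_bound (hρ x) (hρ y) hc hc1
    (dist_nonneg (x := x) (y := y)) hk0 (by simpa only [dist_comm] using hlow y x)
  set C := c⁻¹ * 2 ^ k with hCdef
  have hC : 0 < C := by positivity
  have hCc : C⁻¹ ≤ c := by
    rw [hCdef, mul_inv, inv_inv]
    exact mul_le_of_le_one_right hc.le
      (inv_le_one_of_one_le₀ (Real.one_le_rpow one_le_two hk0.le))
  have hmain : ∀ x y : En n,
      C⁻¹ * criticalRadius n V x *
          (1 + dist x y / criticalRadius n V x) ^ (-k) ≤ criticalRadius n V y ∧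
      criticalRadius n V y ≤ C * criticalRadius n V x *
          (1 + dist x y / criticalRadius n V x) ^ (k / (k + 1)) := by
    refine fun x y => ⟨le_trans ?_ (hlow x y), hup x y⟩
    have := hρ x
    gcongr
  refine ⟨⟨C, hC, k, hk, hmain⟩, fun c' hc' => ⟨C * (1 + c') ^ k, by positivity, ?_⟩⟩
  intro x y hxy
  have hx := hρ x
  have hX : dist x y / criticalRadius n V x ≤ c' := (div_le_iff₀ hx).2 hxy
  have hX0 : 0 ≤ dist x y / criticalRadius n V x := by positivity
  constructor
  · refine le_trans ?_ (hmain x y).1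
    rw [mul_inv, ← Real.rpow_neg (by positivity), mul_right_comm]
    gcongr ?_ * ?_
    exact Real.rpow_le_rpow_of_nonpos (by positivity) (by linarith) (by linarith)
  · refine (hmain x y).2.trans ?_
    rw [mul_right_comm C]
    refine mul_le_mul_of_nonneg_right (mul_le_mul_of_nonneg_left ?_ hC.le) hx.le
    calc (1 + dist x y / criticalRadius n V x) ^ (k / (k + 1))
        ≤ (1 + c') ^ (k / (k + 1)) := by gcongr
      _ ≤ (1 + c') ^ k := Real.rpow_le_rpow_of_exponent_le (by linarith)
          (div_le_self hk0.le (by linarith))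
end
end

section
/- Let n ≥ 3 and let V ∈ B_q(ℝⁿ) for some q > n/2, with V not equal to zero almost everywhere. Then for every x ∈ ℝⁿ the critical radius is a well-defined positive finite number: 0 < ρ(x) < ∞. -/
open MeasureTheory Metric Set
open RealInnerProductSpace

noncomputable section

theorem integrableOn_ball_of_locallyIntegrable {n : ℕ} {f : En n → ℝ}
    (hf : LocallyIntegrable f volume) (x : En n) (r : ℝ) : IntegrableOn f (ball x r) volume :=
  (hf.integrableOn_isCompact (isCompact_closedBall x r)).mono_set ball_subset_closedBall

theorem toReal_volume_ball {n : ℕ} (x : En n) {r : ℝ} (hr : 0 < r) :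
    (volume (ball x r)).toReal = r ^ n * (volume (ball (0 : En n) 1)).toReal := by
  rw [Measure.addHaar_ball_of_pos _ _ hr, ENNReal.toReal_mul, finrank_euclideanSpace_fin,
    ENNReal.toReal_ofReal (by positivity)]

theorem average_rpow_le {n : ℕ} {q : ℝ} (hq : 1 ≤ q) {V : En n → ℝ} (h0 : ∀ x, 0 ≤ V x)
    (hV : LocallyIntegrable V volume) (hVq : LocallyIntegrable (fun y => V y ^ q) volume)
    (x : En n) {r : ℝ} (hr : 0 < r) :
    ((volume (ball x r)).toReal⁻¹ * ∫ y in ball x r, V y) ^ q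
      ≤ (volume (ball x r)).toReal⁻¹ * ∫ y in ball x r, V y ^ q := by
  have h := (convexOn_rpow hq).map_set_average_le (μ := volume) (t := ball x r) (f := V)
    (Real.continuous_rpow_const (by linarith)).continuousOn isClosed_Ici
    (measure_ball_pos volume x hr).ne' measure_ball_lt_top.ne
    (Filter.Eventually.of_forall h0) (integrableOn_ball_of_locallyIntegrable hV x r)
    (integrableOn_ball_of_locallyIntegrable hVq x r)
  simpa only [setAverage_eq, smul_eq_mul, measureReal_def, Function.comp_def] using h

/-- Scale comparison for the normalized mass of a reverse Hölder weight. -/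
theorem ReverseHolderWith.normalized_mass_le {n : ℕ} {q C : ℝ} (hq : 1 ≤ q) {V : En n → ℝ}
    (hV : ReverseHolderWith n q V C) (x : En n) {r R : ℝ} (hr : 0 < r)
    (hrR : r ≤ R) :
    r ^ ((2 : ℝ) - n) * ∫ y in ball x r, V y
      ≤ C * (r / R) ^ (2 - n / q) * (R ^ ((2 : ℝ) - n) * ∫ y in ball x R, V y) := by
  obtain ⟨h0, hint, hintq, hrev⟩ := hV
  have hR : 0 < R := hr.trans_le hrR
  have hq0 : 0 < q := by linarith
  have hJ : ∫ y in ball x r, V y ^ q ≤ ∫ y in ball x R, V y ^ q :=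
    setIntegral_mono_set (integrableOn_ball_of_locallyIntegrable hintq x R)
      (Filter.Eventually.of_forall fun y => Real.rpow_nonneg (h0 y) q)
      (ball_subset_ball hrR).eventuallyLE
  have h1 := average_rpow_le hq h0 hint hintq x hr
  have h2 := hrev x R hR
  have hI : 0 ≤ ∫ y in ball x r, V y := integral_nonneg h0
  have hJ0 : 0 ≤ ∫ y in ball x R, V y ^ q := integral_nonneg fun y => Real.rpow_nonneg (h0 y) q
  have hv : 0 < (volume (ball (0 : En n) 1)).toReal :=
    ENNReal.toReal_pos (measure_ball_pos volume _ one_pos).ne' measure_ball_lt_top.ne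
  rw [toReal_volume_ball x hr] at h1
  rw [toReal_volume_ball x hR] at h2
  generalize (volume (ball (0 : En n) 1)).toReal = v at *
  generalize (∫ y in ball x r, V y) = I at *
  generalize (∫ y in ball x R, V y) = I' at *
  generalize (∫ y in ball x r, V y ^ q) = J at *
  generalize (∫ y in ball x R, V y ^ q) = J' at *
  have h3 : (r ^ n * v)⁻¹ * I ≤ (R / r) ^ (n / q) * (C * ((R ^ n * v)⁻¹ * I')) := by
    calc (r ^ n * v)⁻¹ * I ≤ ((r ^ n * v)⁻¹ * J) ^ q⁻¹ :=
          (Real.le_rpow_inv_iff_of_pos (by positivity)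
            ((Real.rpow_nonneg (by positivity) q).trans h1) hq0).2 h1
      _ ≤ ((r ^ n * v)⁻¹ * J') ^ q⁻¹ := by
          refine Real.rpow_le_rpow ((Real.rpow_nonneg (by positivity) q).trans h1) ?_
            (by positivity)
          gcongr
      _ = ((R / r) ^ n * ((R ^ n * v)⁻¹ * J')) ^ q⁻¹ := by
          congr 1
          rw [div_pow]
          field_simp
      _ = (R / r) ^ (n / q) * ((R ^ n * v)⁻¹ * J') ^ q⁻¹ := by
          rw [Real.mul_rpow (by positivity) (by positivity), ← Real.rpow_natCast,
            ← Real.rpow_mul (by positivity), div_eq_mul_inv (n : ℝ)]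
      _ ≤ _ := by gcongr
  have h4 := mul_le_mul_of_nonneg_left h3 (by positivity : 0 ≤ r ^ 2 * v)
  have e1 : r ^ 2 * v * ((r ^ n * v)⁻¹ * I) = r ^ ((2 : ℝ) - n) * I := by
    rw [Real.rpow_sub hr, Real.rpow_natCast, Real.rpow_two]
    field_simp
  have e2 : r ^ 2 * v * ((R / r) ^ (n / q) * (C * ((R ^ n * v)⁻¹ * I')))
      = C * (r / R) ^ (2 - n / q) * (R ^ ((2 : ℝ) - n) * I') := by
    rw [Real.rpow_sub hR, Real.rpow_natCast, Real.rpow_two, Real.rpow_sub (by positivity),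
      Real.rpow_two, ← inv_div r R, Real.inv_rpow (by positivity)]
    field_simp
  rwa [e1, e2] at h4

theorem exists_setIntegral_ball_pos {n : ℕ} {V : En n → ℝ} (h0 : ∀ x, 0 ≤ V x)
    (hV : LocallyIntegrable V volume) (hne : ¬ ∀ᵐ x ∂(volume : Measure (En n)), V x = 0)
    (x : En n) : ∃ r : ℝ, 0 < r ∧ 0 < ∫ y in ball x r, V y := by
  by_contra! hcon
  refine hne ?_
  have hball : ∀ k : ℕ, ∀ᵐ y ∂(volume.restrict (ball x (k + 1 : ℝ))), V y = 0 := fun k =>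
    (integral_eq_zero_iff_of_nonneg h0 (integrableOn_ball_of_locallyIntegrable hV x _)).1
      (le_antisymm (hcon _ (by positivity)) (integral_nonneg h0))
  have hU : ⋃ k : ℕ, ball x (k + 1 : ℝ) = univ := by
    refine eq_univ_of_forall fun y => ?_
    obtain ⟨k, hk⟩ := exists_nat_gt (dist y x)
    exact mem_iUnion.2 ⟨k, mem_ball.2 (by linarith)⟩
  have h := (ae_restrict_iUnion_iff (fun k : ℕ => ball x (k + 1 : ℝ)) (fun y => V y = 0)).2 hball
  rwa [hU, Measure.restrict_univ] at h

/-- The critical radius `ρ(x)` is a well-defined positive finite number. -/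
theorem statement1 (n : ℕ) (hn : 3 ≤ n) (q : ℝ) (hq : (n : ℝ) / 2 < q)
    (V : En n → ℝ) (hV : ReverseHolder n q V)
    (hV0 : ¬ (∀ᵐ x ∂(volume : Measure (En n)), V x = 0)) :
    ∀ x : En n,
      ({r : ℝ | 0 < r ∧ r ^ ((2 : ℝ) - n) * ∫ y in ball x r, V y ≤ 1}).Nonempty ∧
      BddAbove {r : ℝ | 0 < r ∧ r ^ ((2 : ℝ) - n) * ∫ y in ball x r, V y ≤ 1} ∧
      0 < criticalRadius n V x := by
  intro x
  obtain ⟨C, hC, hRH⟩ := hV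
  have hn' : (3 : ℝ) ≤ n := by exact_mod_cast hn
  have hq1 : 1 ≤ q := by linarith
  have hα : 0 < 2 - n / q := by
    rw [sub_pos, div_lt_iff₀ (by linarith)]
    linarith
  have key := fun {r R : ℝ} => hRH.normalized_mass_le hq1 x (r := r) (R := R)
  have hne : ∃ r : ℝ, 0 < r ∧ r ^ ((2 : ℝ) - n) * ∫ y in ball x r, V y ≤ 1 := by
    have hcont : Filter.Tendsto
        (fun r : ℝ => C * (r / 1) ^ (2 - n / q) * (1 ^ ((2 : ℝ) - n) * ∫ y in ball x 1, V y))
        (nhdsWithin 0 (Ioi 0)) (nhds 0) := by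
      have h : Continuous fun r : ℝ =>
          C * (r / 1) ^ (2 - n / q) * (1 ^ ((2 : ℝ) - n) * ∫ y in ball x 1, V y) :=
        (((Real.continuous_rpow_const hα.le).comp (continuous_id.div_const 1)).const_mul C).mul_const
          _
      simpa [Real.zero_rpow hα.ne'] using (h.tendsto 0).mono_left nhdsWithin_le_nhds
    obtain ⟨r, hr, hr0, hr1⟩ := ((hcont.eventually_le_const one_pos).and
      (Ioc_mem_nhdsGT one_pos)).exists
    exact ⟨r, hr0, (key hr0 hr1).trans hr⟩
  have hbdd : BddAbove {r : ℝ | 0 < r ∧ r ^ ((2 : ℝ) - n) * ∫ y in ball x r, V y ≤ 1} := by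
    obtain ⟨r, hr, hI⟩ := exists_setIntegral_ball_pos hRH.1 hRH.2.1 hV0 x
    set g := r ^ ((2 : ℝ) - n) * ∫ y in ball x r, V y
    have hg : 0 < g := mul_pos (Real.rpow_pos_of_pos hr _) hI
    refine ⟨max r (r * (C / g) ^ (2 - n / q)⁻¹), ?_⟩
    rintro R ⟨hR, hR1⟩
    rcases le_total R r with h | h
    · exact le_max_of_le_left h
    refine le_max_of_le_right ?_
    have h1 : g ≤ C * (r / R) ^ (2 - n / q) :=
      (key hr h).trans (mul_le_of_le_one_right (by positivity) hR1)
    have h2 : (R / r) ^ (2 - n / q) ≤ C / g := by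
      rw [← inv_div r R, Real.inv_rpow (by positivity), le_div_iff₀ hg,
        inv_mul_le_iff₀ (by positivity)]
      linarith
    rw [← div_le_iff₀' hr]
    exact (Real.le_rpow_inv_iff_of_pos (by positivity) (by positivity) hα).2 h2
  obtain ⟨r, hr⟩ := hne
  exact ⟨⟨r, hr⟩, hbdd, hr.1.trans_le (le_csSup hbdd hr)⟩
end
end

section
/- Let n ≥ 3 and let V ∈ L^q_loc(ℝⁿ) be nonnegative for some q > n/2. Let (x₀,t₀) ∈ ℝⁿ × ℝ, r₀ > 0, and let u be a C¹ function on the parabolic cube B_{r₀}(x₀,t₀) = B(x₀,r₀) × (t₀−r₀², t₀] that is a weak solution of ∂_t u − Δu + Vu = 0 there, i.e. ∫∫ ∇_x u · ∇_x ψ dx dt − ∫∫ u ∂_t ψ dx dt + ∫∫ V u ψ dx dt = 0 for every C¹ function ψ compactly supported in B(x₀,r₀) × (t₀−r₀², t₀). Then there is a constant C depending only on n such that sup_{(x,t) ∈ B(x₀,r₀/4) × (t₀−(r₀/4)², t₀]} |u(x,t)| ≤ C ( r₀^{−(n+2)} ∫_{t₀−(r₀/2)²}^{t₀} ∫_{B(x₀,r₀/2)}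 |u(x,t)|² dx dt )^{1/2}. -/
open MeasureTheory Metric Set
open RealInnerProductSpace

noncomputable section

instance isAddHaarMeasure_volume_En_prod (n : ℕ) :
    (volume : Measure (En n × ℝ)).IsAddHaarMeasure := by
  rw [Measure.volume_eq_prod]; infer_instance

/-- The `i`-th spatial direction in space-time. -/
abbrev spaceDir {n : ℕ} (i : Fin n) : En n × ℝ := (EuclideanSpace.single i 1, 0)

/-- The heat operator `∂ₜ + Δ` (backward in time), in terms of iterated partial derivatives. -/
def backwardHeat {n : ℕ} (φ : En n × ℝ → ℝ) (p : En n × ℝ) : ℝ :=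
  ∑ i, fderiv ℝ (fun q => fderiv ℝ φ q (spaceDir i)) p (spaceDir i) + fderiv ℝ φ p (0, 1)

lemma ContDiffOn.mul_of_eq_zero_off {E : Type*} [NormedAddCommGroup E] [NormedSpace ℝ E]
    {m : WithTop ℕ∞} {S K : Set E} {f g : E → ℝ} (hS : IsOpen S) (hK : IsClosed K) (hKS : K ⊆ S)
    (hf : ContDiffOn ℝ m f S) (hg : ContDiff ℝ m g) (h0 : ∀ p ∉ K, g p = 0) :
    ContDiff ℝ m (fun p => f p * g p) := by
  rw [contDiff_iff_contDiffAt]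
  intro p
  by_cases hp : p ∈ K
  · exact (hf.contDiffAt (hS.mem_nhds (hKS hp))).mul hg.contDiffAt
  · refine (contDiffAt_const (c := (0 : ℝ))).congr_of_eventuallyEq ?_
    filter_upwards [hK.isOpen_compl.mem_nhds hp] with q hq
    simp [h0 q hq]

lemma ContinuousOn.mul_of_eq_zero_off {E : Type*} [TopologicalSpace E]
    {S K : Set E} {f g : E → ℝ} (hS : IsOpen S) (hK : IsClosed K) (hKS : K ⊆ S)
    (hf : ContinuousOn f S) (hg : Continuous g) (h0 : ∀ p ∉ K, g p = 0) :
    Continuous (fun p => f p * g p) := by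
  rw [continuous_iff_continuousAt]
  intro p
  by_cases hp : p ∈ K
  · exact (hf.continuousAt (hS.mem_nhds (hKS hp))).mul hg.continuousAt
  · refine (continuousAt_const (y := (0 : ℝ))).congr_of_eventuallyEq ?_
    filter_upwards [hK.isOpen_compl.mem_nhds hp] with q hq
    simp [h0 q hq]

lemma fderiv_eq_zero_of_notMem {E F : Type*} [NormedAddCommGroup E] [NormedSpace ℝ E]
    [NormedAddCommGroup F] [NormedSpace ℝ F] {K : Set E} {g : E → F} (hK : IsClosed K)
    (h0 : ∀ p ∉ K, g p = 0) : ∀ p ∉ K, fderiv ℝ g p = 0 := by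
  intro p hp
  have : g =ᶠ[nhds p] fun _ => 0 := by
    filter_upwards [hK.isOpen_compl.mem_nhds hp] with q hq using h0 q hq
  rw [this.fderiv_eq]; simp

lemma integrable_of_eq_zero_off {E : Type*} [TopologicalSpace E] [R1Space E] [MeasurableSpace E]
    [OpensMeasurableSpace E] {μ : Measure E} [IsFiniteMeasureOnCompacts μ] {K : Set E} {f : E → ℝ}
    (hf : Continuous f) (hK : IsCompact K) (h0 : ∀ p ∉ K, f p = 0) :
    Integrable f μ :=
  hf.integrable_of_hasCompactSupport (HasCompactSupport.intro hK h0)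

lemma integrable_fderiv_apply_of_eq_zero_off {E : Type*} [NormedAddCommGroup E] [NormedSpace ℝ E]
    [MeasurableSpace E] [BorelSpace E] {μ : Measure E} [IsFiniteMeasureOnCompacts μ] {K : Set E}
    {f : E → ℝ} (hf : ContDiff ℝ 1 f) (hK : IsCompact K) (h0 : ∀ p ∉ K, f p = 0) (v : E) :
    Integrable (fun p => fderiv ℝ f p v) μ := by
  refine integrable_of_eq_zero_off ?_ hK ?_
  · exact (hf.continuous_fderiv (by simp)).clm_apply continuous_const
  · intro p hp; simp [fderiv_eq_zero_of_notMem hK.isClosed h0 p hp]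

lemma integral_fderiv_apply_eq_zero {E : Type*} [NormedAddCommGroup E] [NormedSpace ℝ E]
    [MeasurableSpace E] [BorelSpace E] [FiniteDimensional ℝ E] {μ : Measure E}
    [μ.IsAddHaarMeasure] {K : Set E} {f : E → ℝ} (hf : ContDiff ℝ 1 f) (hK : IsCompact K)
    (h0 : ∀ p ∉ K, f p = 0) (v : E) :
    ∫ p, fderiv ℝ f p v ∂μ = 0 := by
  have h := integral_mul_fderiv_eq_neg_fderiv_mul_of_integrable (μ := μ) (f := fun _ : E => (1 : ℝ))
    (g := f) (v := v) (by simp)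
    (by simpa using integrable_fderiv_apply_of_eq_zero_off hf hK h0 v)
    (by simpa using integrable_of_eq_zero_off hf.continuous hK h0)
    (fun x _ => by fun_prop) (fun x _ => hf.differentiable (by simp) x)
  simpa using h

lemma backwardHeat_eq_zero_of_notMem {n : ℕ} {φ : En n × ℝ → ℝ} {K : Set (En n × ℝ)}
    (hK : IsClosed K) (h0 : ∀ p ∉ K, φ p = 0) : ∀ p ∉ K, backwardHeat φ p = 0 := by
  intro p hp
  have hd0 := fderiv_eq_zero_of_notMem hK h0
  have hd1 : ∀ i : Fin n, fderiv ℝ (fun q => fderiv ℝ φ q (spaceDir i)) p = 0 := fun i =>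
    fderiv_eq_zero_of_notMem hK (fun q hq => by simp [hd0 q hq]) p hp
  simp [backwardHeat, hd0 p hp, hd1]

lemma gradient_slice_apply {n : ℕ} {f : En n → ℝ → ℝ} {p : En n × ℝ}
    (hf : DifferentiableAt ℝ (fun q : En n × ℝ => f q.1 q.2) p) (i : Fin n) :
    gradient (fun y => f y p.2) p.1 i
      = fderiv ℝ (fun q : En n × ℝ => f q.1 q.2) p (spaceDir i) := by
  have h1 : HasFDerivAt (fun y : En n => (y, p.2)) (ContinuousLinearMap.inl ℝ (En n) ℝ) p.1 :=
    hasFDerivAt_prodMk_left p.1 p.2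
  have h2 := HasFDerivAt.comp p.1 (g := fun q : En n × ℝ => f q.1 q.2) hf.hasFDerivAt h1
  have h3 : fderiv ℝ (fun y => f y p.2) p.1 = _ := h2.fderiv
  have h4 : gradient (fun y => f y p.2) p.1 i
      = inner ℝ (gradient (fun y => f y p.2) p.1) (EuclideanSpace.single i 1) := by
    rw [EuclideanSpace.inner_single_right]; simp
  rw [h4, gradient, InnerProductSpace.toDual_symm_apply, h3]
  simp

lemma inner_gradient_slice {n : ℕ} {f g : En n → ℝ → ℝ} {p : En n × ℝ}
    (hf : DifferentiableAt ℝ (fun q : En n × ℝ => f q.1 q.2) p)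
    (hg : DifferentiableAt ℝ (fun q : En n × ℝ => g q.1 q.2) p) :
    ⟪gradient (fun y => f y p.2) p.1, gradient (fun y => g y p.2) p.1⟫
      = ∑ i, fderiv ℝ (fun q : En n × ℝ => f q.1 q.2) p (spaceDir i)
          * fderiv ℝ (fun q : En n × ℝ => g q.1 q.2) p (spaceDir i) := by
  rw [PiLp.inner_apply]
  refine Finset.sum_congr rfl fun i _ => ?_
  rw [gradient_slice_apply hf, gradient_slice_apply hg]
  simp [mul_comm]

lemma deriv_slice {n : ℕ} {f : En n → ℝ → ℝ} {p : En n × ℝ}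
    (hf : DifferentiableAt ℝ (fun q : En n × ℝ => f q.1 q.2) p) :
    deriv (f p.1) p.2 = fderiv ℝ (fun q : En n × ℝ => f q.1 q.2) p (0, 1) := by
  have h1 : HasFDerivAt (fun s : ℝ => (p.1, s)) (ContinuousLinearMap.inr ℝ (En n) ℝ) p.2 :=
    hasFDerivAt_prodMk_right p.1 p.2
  have h2 := HasFDerivAt.comp_hasDerivAt p.2 (l := fun q : En n × ℝ => f q.1 q.2)
    hf.hasFDerivAt h1.hasDerivAt
  have h3 : deriv (f p.1) p.2 = _ := h2.deriv
  rw [h3]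
  simp

lemma integral_half_combination {α : Type*} [MeasurableSpace α] {μ : Measure α}
    {a b c d : α → ℝ} (ha : Integrable a μ) (hb : Integrable b μ) (hc : Integrable c μ)
    (hd : Integrable d μ) :
    ∫ p, (a p + 1 / 2 * b p - 1 / 2 * c p + 1 / 2 * d p) ∂μ
      = ∫ p, a p ∂μ + 1 / 2 * ∫ p, b p ∂μ - 1 / 2 * ∫ p, c p ∂μ + 1 / 2 * ∫ p, d p ∂μ := by
  have hb' := hb.const_mul (1 / 2)
  have hc' := hc.const_mul (1 / 2)
  have hd' := hd.const_mul (1 / 2)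
  have hab : Integrable (fun p => a p + 1 / 2 * b p) μ := ha.add hb'
  have habc : Integrable (fun p => a p + 1 / 2 * b p - 1 / 2 * c p) μ := hab.sub hc'
  rw [integral_add habc hd', integral_sub hab hc', integral_add ha hb']
  simp only [integral_const_mul]

/-- The square of a weak solution is a weak subsolution of the heat equation. -/
lemma IsCaloricOn.integral_sq_mul_backwardHeat_nonneg {n : ℕ} {V : En n → ℝ} (hV : ∀ x, 0 ≤ V x)
    {u : En n → ℝ → ℝ} {S K : Set (En n × ℝ)} (hS : IsOpen S)
    (hu : ContDiffOn ℝ 1 (fun p : En n × ℝ => u p.1 p.2) S) (hcal : IsCaloricOn n V u S)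
    (hK : IsCompact K) (hKS : K ⊆ S) {φ : En n × ℝ → ℝ} (hφ : ContDiff ℝ 2 φ)
    (hφ0 : ∀ p, 0 ≤ φ p) (h0 : ∀ p ∉ K, φ p = 0) :
    Integrable (fun p : En n × ℝ => u p.1 p.2 ^ 2 * backwardHeat φ p) ∧
      0 ≤ ∫ p : En n × ℝ, u p.1 p.2 ^ 2 * backwardHeat φ p := by
  set U : En n × ℝ → ℝ := fun p => u p.1 p.2 with hU
  have hKc := hK.isClosed
  have hφ1 : ContDiff ℝ 1 φ := hφ.of_le (by norm_num)
  have hd0 := fderiv_eq_zero_of_notMem hKc h0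
  have hG : ∀ i : Fin n, ContDiff ℝ 1 (fun q => fderiv ℝ φ q (spaceDir i)) := fun i =>
    (hφ.fderiv_right (m := 1) (by norm_num)).clm_apply contDiff_const
  have hG0 : ∀ i : Fin n, ∀ p ∉ K, fderiv ℝ φ p (spaceDir i) = 0 := fun i p hp => by
    simp [hd0 p hp]
  have hL0 : ∀ p ∉ K, backwardHeat φ p = 0 := backwardHeat_eq_zero_of_notMem hKc h0
  have hLc : Continuous (backwardHeat φ) := by
    unfold backwardHeat
    refine Continuous.add (continuous_finsetSum _ fun i _ => ?_) ?_
    · exact ((hG i).continuous_fderiv (by simp)).clm_apply continuous_const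
    · exact (hφ1.continuous_fderiv (by simp)).clm_apply continuous_const
  have hU2 : ContDiffOn ℝ 1 (fun p => U p ^ 2) S := hu.pow 2
  have hψ : ContDiff ℝ 1 (fun p => U p * φ p) := hu.mul_of_eq_zero_off hS hKc hKS hφ1 h0
  have hψ0 : ∀ p ∉ K, U p * φ p = 0 := fun p hp => by simp [h0 p hp]
  have hwφ : ContDiff ℝ 1 (fun p => U p ^ 2 * φ p) := hU2.mul_of_eq_zero_off hS hKc hKS hφ1 h0
  have hwφ0 : ∀ p ∉ K, U p ^ 2 * φ p = 0 := fun p hp => by simp [h0 p hp]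
  have hwG : ∀ i, ContDiff ℝ 1 (fun p => U p ^ 2 * fderiv ℝ φ p (spaceDir i)) := fun i =>
    hU2.mul_of_eq_zero_off hS hKc hKS (hG i) (hG0 i)
  have hwG0 : ∀ i : Fin n, ∀ p ∉ K, U p ^ 2 * fderiv ℝ φ p (spaceDir i) = 0 := fun i p hp => by
    simp [hG0 i p hp]
  have hUf := hu.continuousOn_fderiv_of_isOpen hS le_rfl
  have hIL : Integrable (fun p => U p ^ 2 * backwardHeat φ p) :=
    integrable_of_eq_zero_off (hU2.continuousOn.mul_of_eq_zero_off hS hKc hKS hLc hL0) hK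
      fun p hp => by simp [hL0 p hp]
  refine ⟨hIL, ?_⟩
  have hIφt : Integrable (fun p => U p ^ 2 * fderiv ℝ φ p (0, 1)) :=
    integrable_of_eq_zero_off (hU2.continuousOn.mul_of_eq_zero_off hS hKc hKS
      ((hφ1.continuous_fderiv (by simp)).clm_apply continuous_const)
      fun p hp => by simp [hd0 p hp]) hK fun p hp => by simp [hd0 p hp]
  have hIgrad : Integrable (fun p => (∑ i : Fin n, fderiv ℝ U p (spaceDir i) ^ 2) * φ p) := by
    refine integrable_of_eq_zero_off (ContinuousOn.mul_of_eq_zero_off hS hKc hKS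
      (continuousOn_finsetSum _ fun i _ => ?_) hφ.continuous h0) hK fun p hp => by simp [h0 p hp]
    exact (hUf.clm_apply continuousOn_const).pow 2
  have hIdiv : ∀ i, Integrable
      (fun p => fderiv ℝ (fun q => U q ^ 2 * fderiv ℝ φ q (spaceDir i)) p (spaceDir i)) := fun i =>
    integrable_fderiv_apply_of_eq_zero_off (hwG i) hK (hwG0 i) _
  have hIt : Integrable (fun p => fderiv ℝ (fun q => U q ^ 2 * φ q) p (0, 1)) :=
    integrable_fderiv_apply_of_eq_zero_off hwφ hK hwφ0 _
  have hUd : ∀ p ∈ K, DifferentiableAt ℝ U p := fun p hp =>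
    (hu.contDiffAt (hS.mem_nhds (hKS hp))).differentiableAt (by simp)
  have hφd : ∀ p, DifferentiableAt ℝ φ p := fun p => hφ1.differentiable (by simp) p
  have hψf : ∀ p ∈ K, ∀ v, fderiv ℝ (fun q => U q * φ q) p v
      = U p * fderiv ℝ φ p v + φ p * fderiv ℝ U p v := fun p hp v => by
    rw [fderiv_fun_mul (hUd p hp) (hφd p)]; simp
  have hsq : ∀ p ∈ K, ∀ g : En n × ℝ → ℝ, DifferentiableAt ℝ g p → ∀ v,
      fderiv ℝ (fun q => U q ^ 2 * g q) p v
        = U p ^ 2 * fderiv ℝ g p v + g p * (2 * U p * fderiv ℝ U p v) := by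
    intro p hp g hg v
    rw [fderiv_fun_mul ((hUd p hp).fun_pow 2) hg, fderiv_fun_pow 2 (hUd p hp)]; simp
  have hA : ∀ p : En n × ℝ, ⟪gradient (fun y => u y p.2) p.1,
        gradient (fun y => u y p.2 * φ (y, p.2)) p.1⟫
      = (∑ i : Fin n, fderiv ℝ U p (spaceDir i) ^ 2) * φ p
        + (1 / 2) * (∑ i : Fin n,
            fderiv ℝ (fun q => U q ^ 2 * fderiv ℝ φ q (spaceDir i)) p (spaceDir i))
        - (1 / 2) * (U p ^ 2 * backwardHeat φ p)
        + (1 / 2) * (U p ^ 2 * fderiv ℝ φ p (0, 1)) := by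
    intro p
    by_cases hp : p ∈ K
    · rw [inner_gradient_slice (f := u) (g := fun y s => u y s * φ (y, s)) (hUd p hp)
        (hψ.differentiable (by simp) p)]
      change ∑ i, fderiv ℝ U p (spaceDir i) * fderiv ℝ (fun q => U q * φ q) p (spaceDir i) = _
      simp_rw [hψf p hp, hsq p hp _ ((hG _).differentiable (by simp) p)]
      rw [backwardHeat, Finset.sum_add_distrib, ← Finset.mul_sum, mul_add (U p ^ 2),
        Finset.sum_mul]
      have : ∀ a b c d e : ℝ, e = a + 1 / 2 * c →
        e = a + 1 / 2 * (b + c) - 1 / 2 * (b + d) + 1 / 2 * d := by intros; linarith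
      apply this
      rw [Finset.mul_sum, ← Finset.sum_add_distrib]
      exact Finset.sum_congr rfl fun i _ => by ring
    · have hz : gradient (fun y => u y p.2 * φ (y, p.2)) p.1 = 0 := by
        ext i
        rw [gradient_slice_apply (f := fun y s => u y s * φ (y, s))
          (hψ.differentiable (by simp) p)]
        change fderiv ℝ (fun q => U q * φ q) p (spaceDir i) = _
        simp [fderiv_eq_zero_of_notMem hKc hψ0 p hp]
      simp [hz, h0 p hp, hL0 p hp, hd0 p hp, fderiv_eq_zero_of_notMem hKc (hwG0 _) p hp]
  have hB : ∀ p : En n × ℝ, u p.1 p.2 * deriv (fun s => u p.1 s * φ (p.1, s)) p.2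
      = (1 / 2) * fderiv ℝ (fun q => U q ^ 2 * φ q) p (0, 1)
        + (1 / 2) * (U p ^ 2 * fderiv ℝ φ p (0, 1)) := by
    intro p
    rw [deriv_slice (f := fun y s => u y s * φ (y, s)) (hψ.differentiable (by simp) p)]
    change U p * fderiv ℝ (fun q => U q * φ q) p (0, 1) = _
    by_cases hp : p ∈ K
    · rw [hψf p hp, hsq p hp _ (hφd p)]; ring
    · simp [fderiv_eq_zero_of_notMem hKc hψ0 p hp, fderiv_eq_zero_of_notMem hKc hwφ0 p hp,
        hd0 p hp]
  have hmain := hcal (fun y s => u y s * φ (y, s)) hψ (HasCompactSupport.intro hK hψ0)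
    ((closure_minimal (fun p hp => by by_contra h; exact hp (hψ0 p h)) hKc).trans hKS)
  have hVnn : 0 ≤ ∫ p : En n × ℝ, V p.1 * u p.1 p.2 * (u p.1 p.2 * φ (p.1, p.2)) := by
    refine integral_nonneg fun p => ?_
    have : V p.1 * u p.1 p.2 * (u p.1 p.2 * φ (p.1, p.2)) = V p.1 * (u p.1 p.2 ^ 2 * φ p) := by
      ring
    simp only [this]
    exact mul_nonneg (hV _) (mul_nonneg (sq_nonneg _) (hφ0 p))
  have hgnn : 0 ≤ ∫ p : En n × ℝ, (∑ i : Fin n, fderiv ℝ U p (spaceDir i) ^ 2) * φ p :=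
    integral_nonneg fun p => mul_nonneg (Finset.sum_nonneg fun i _ => sq_nonneg _) (hφ0 p)
  simp only [hA, hB] at hmain
  rw [integral_half_combination hIgrad (integrable_finsetSum Finset.univ fun i _ => hIdiv i) hIL
    hIφt, integral_add (hIt.const_mul _) (hIφt.const_mul _)] at hmain
  simp only [integral_const_mul] at hmain
  rw [integral_finsetSum _ fun i _ => hIdiv i, integral_fderiv_apply_eq_zero hwφ hK hwφ0,
    Finset.sum_eq_zero fun i _ => integral_fderiv_apply_eq_zero (hwG i) hK (hwG0 i) _] at hmain
  linarith

/-- The backward heat operator applied to a function of `z = (‖y‖², s)`, for `y ∈ ℝⁿ`. -/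
def radialHeat (n : ℕ) (F : ℝ × ℝ → ℝ) (z : ℝ × ℝ) : ℝ :=
  fderiv ℝ F z (0, 1) + 4 * z.1 * fderiv ℝ (fun w => fderiv ℝ F w (1, 0)) z (1, 0)
    + 2 * n * fderiv ℝ F z (1, 0)

/-- Parabolic rescaling by `a` around `(x, t)`, recording only the squared distance to `x`. -/
def radialCoord {n : ℕ} (x : En n) (t a : ℝ) (p : En n × ℝ) : ℝ × ℝ :=
  (a * ‖p.1 - x‖ ^ 2, a * (p.2 - t))

lemma contDiff_radialCoord {n : ℕ} (x : En n) (t a : ℝ) {m : WithTop ℕ∞} :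
    ContDiff ℝ m (radialCoord x t a) := by
  unfold radialCoord
  exact (contDiff_const.mul ((contDiff_fst.sub contDiff_const).norm_sq ℝ)).prodMk
    (contDiff_const.mul (contDiff_snd.sub contDiff_const))

lemma fderiv_radialCoord_apply {n : ℕ} (x : En n) (t a : ℝ) (p v : En n × ℝ) :
    fderiv ℝ (radialCoord x t a) p v = (2 * a * inner ℝ (p.1 - x) v.1, a * v.2) := by
  have h1 : HasFDerivAt (fun q : En n × ℝ => q.1 - x) (ContinuousLinearMap.fst ℝ (En n) ℝ) p :=
    (hasFDerivAt_fst (p := p)).sub_const x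
  have h2 : HasFDerivAt (fun q : En n × ℝ => q.2 - t) (ContinuousLinearMap.snd ℝ (En n) ℝ) p :=
    (hasFDerivAt_snd (p := p)).sub_const t
  have h3 : fderiv ℝ (radialCoord x t a) p = _ :=
    ((h1.norm_sq.const_mul a).prodMk (h2.const_mul a)).fderiv
  rw [h3]
  simp [inner_sub_left]
  ring

lemma fderiv_comp_radialCoord_spaceDir {n : ℕ} (x : En n) (t a : ℝ) {F : ℝ × ℝ → ℝ}
    (hF : Differentiable ℝ F) (p : En n × ℝ) (i : Fin n) :
    fderiv ℝ (fun q => F (radialCoord x t a q)) p (spaceDir i)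
      = 2 * a * (p.1 i - x i) * fderiv ℝ F (radialCoord x t a p) (1, 0) := by
  have hd := (contDiff_radialCoord x t a (m := 1)).differentiable (by simp) p
  have h : fderiv ℝ (fun q => F (radialCoord x t a q)) p = _ :=
    fderiv_comp p (hF (radialCoord x t a p)) hd
  rw [h, ContinuousLinearMap.comp_apply, fderiv_radialCoord_apply]
  have : ((2 * a * inner ℝ (p.1 - x) (spaceDir i : En n × ℝ).1, a * (spaceDir i : En n × ℝ).2)
      : ℝ × ℝ) = (2 * a * (p.1 i - x i)) • ((1 : ℝ), (0 : ℝ)) := by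
    simp [EuclideanSpace.inner_single_right]
  rw [this, map_smul, smul_eq_mul]

lemma backwardHeat_comp_radialCoord {n : ℕ} (x : En n) (t a : ℝ) {F : ℝ × ℝ → ℝ}
    (hF : ContDiff ℝ 2 F) (p : En n × ℝ) :
    backwardHeat (fun q => F (radialCoord x t a q)) p
      = a * radialHeat n F (radialCoord x t a p) := by
  have hFd : Differentiable ℝ F := hF.differentiable (by simp)
  have hF1 : ContDiff ℝ 1 (fun w => fderiv ℝ F w (1, 0)) :=
    (hF.fderiv_right (m := 1) (by norm_num)).clm_apply contDiff_const
  have hF1d : Differentiable ℝ (fun w => fderiv ℝ F w (1, 0)) := hF1.differentiable (by simp)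
  have hrd := (contDiff_radialCoord x t a (m := 1)).differentiable (by simp)
  have ht : fderiv ℝ (fun q => F (radialCoord x t a q)) p (0, 1)
      = a * fderiv ℝ F (radialCoord x t a p) (0, 1) := by
    have h : fderiv ℝ (fun q => F (radialCoord x t a q)) p = _ :=
      fderiv_comp p (hFd (radialCoord x t a p)) (hrd p)
    rw [h, ContinuousLinearMap.comp_apply, fderiv_radialCoord_apply]
    have : ((2 * a * inner ℝ (p.1 - x) ((0, 1) : En n × ℝ).1, a * ((0, 1) : En n × ℝ).2)
        : ℝ × ℝ) = a • ((0 : ℝ), (1 : ℝ)) := by simp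
    rw [this, map_smul, smul_eq_mul]
  have hi : ∀ i : Fin n,
      fderiv ℝ (fun q => fderiv ℝ (fun q => F (radialCoord x t a q)) q (spaceDir i)) p (spaceDir i)
      = 2 * a * fderiv ℝ F (radialCoord x t a p) (1, 0)
        + 4 * a ^ 2 * (p.1 i - x i) ^ 2
          * fderiv ℝ (fun w => fderiv ℝ F w (1, 0)) (radialCoord x t a p) (1, 0) := by
    intro i
    simp_rw [fderiv_comp_radialCoord_spaceDir x t a hFd]
    have hc : HasFDerivAt (fun q : En n × ℝ => 2 * a * (q.1 i - x i))
        ((2 * a) • ((EuclideanSpace.proj i : En n →L[ℝ] ℝ).comp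
          (ContinuousLinearMap.fst ℝ (En n) ℝ))) p := by
      have h1 : HasFDerivAt (fun q : En n × ℝ => q.1 i)
        ((EuclideanSpace.proj i : En n →L[ℝ] ℝ).comp (ContinuousLinearMap.fst ℝ (En n) ℝ)) p :=
        ((EuclideanSpace.proj i : En n →L[ℝ] ℝ).comp
          (ContinuousLinearMap.fst ℝ (En n) ℝ)).hasFDerivAt
      exact (h1.sub_const (x i)).const_mul (2 * a)
    rw [fderiv_fun_mul hc.differentiableAt (hF1d.fun_comp hrd p), hc.fderiv]
    have := fderiv_comp_radialCoord_spaceDir x t a hF1d p i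
    simp only [add_apply, smul_apply, smul_eq_mul, this]
    simp
    ring
  unfold backwardHeat radialHeat
  simp_rw [hi, ht]
  rw [Finset.sum_add_distrib, ← Finset.sum_mul _ (fun i => 4 * a ^ 2 * (p.1 i - x i) ^ 2),
    ← Finset.mul_sum _ (fun i => (p.1 i - x i) ^ 2)]
  have hn : ∑ i, (p.1 i - x i) ^ 2 = ‖p.1 - x‖ ^ 2 := by
    rw [EuclideanSpace.real_norm_sq_eq]; simp
  rw [hn]
  simp only [Finset.sum_const, Finset.card_univ, Fintype.card_fin, nsmul_eq_mul, radialCoord]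
  ring

lemma fderiv_apply_one_zero {F : ℝ × ℝ → ℝ} {z : ℝ × ℝ} (hF : DifferentiableAt ℝ F z) {d : ℝ}
    (h : HasDerivAt (fun σ => F (σ, z.2)) d z.1) : fderiv ℝ F z (1, 0) = d := by
  have h1 : HasFDerivAt (fun σ : ℝ => (σ, z.2)) (ContinuousLinearMap.inl ℝ ℝ ℝ) z.1 :=
    hasFDerivAt_prodMk_left z.1 z.2
  have h2 := HasFDerivAt.comp_hasDerivAt z.1 (l := F) hF.hasFDerivAt h1.hasDerivAt
  simpa using h2.unique h

lemma fderiv_apply_zero_one {F : ℝ × ℝ → ℝ} {z : ℝ × ℝ} (hF : DifferentiableAt ℝ F z) {d : ℝ}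
    (h : HasDerivAt (fun s => F (z.1, s)) d z.2) : fderiv ℝ F z (0, 1) = d := by
  have h1 : HasFDerivAt (fun s : ℝ => (z.1, s)) (ContinuousLinearMap.inr ℝ ℝ ℝ) z.2 :=
    hasFDerivAt_prodMk_right z.1 z.2
  have h2 := HasFDerivAt.comp_hasDerivAt z.2 (l := F) hF.hasFDerivAt h1.hasDerivAt
  simpa using h2.unique h

/-- Up to a constant, the backward heat kernel with pole at time `ε`, as a function of `‖y‖²`. -/
def heatProfile (n : ℕ) (ε σ s : ℝ) : ℝ :=
  (ε - s) ^ (-(n : ℝ) / 2) * Real.exp (-σ / (4 * (ε - s)))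

/-- The heat kernel profile multiplied by cutoffs in space, in initial time and in final time. -/
def cutoffProfile (n : ℕ) (ε : ℝ) (z : ℝ × ℝ) : ℝ :=
  Real.smoothTransition (2 - 2 * z.1) *
    (Real.smoothTransition (2 * z.2 + 2) * Real.smoothTransition (-z.2 / ε)) *
      heatProfile n ε z.1 z.2

lemma heatProfile_nonneg (n : ℕ) {ε s : ℝ} (hs : s < ε) (σ : ℝ) : 0 ≤ heatProfile n ε σ s :=
  mul_nonneg (Real.rpow_nonneg (by linarith) _) (Real.exp_pos _).le

lemma hasDerivAt_heatProfile_left (n : ℕ) (ε σ s : ℝ) :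
    HasDerivAt (fun σ => heatProfile n ε σ s) (-1 / (4 * (ε - s)) * heatProfile n ε σ s) σ := by
  unfold heatProfile
  have h := ((((hasDerivAt_id σ).neg).div_const (4 * (ε - s))).exp).const_mul
    ((ε - s) ^ (-(n : ℝ) / 2))
  refine h.congr_deriv ?_
  simp; ring

lemma hasDerivAt_heatProfile_right (n : ℕ) {ε σ s : ℝ} (hs : s < ε) :
    HasDerivAt (fun s => heatProfile n ε σ s)
      ((n / (2 * (ε - s)) - σ / (4 * (ε - s) ^ 2)) * heatProfile n ε σ s) s := by
  unfold heatProfile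
  have hτ : 0 < ε - s := by linarith
  have h0 : HasDerivAt (fun s => ε - s) (-1) s := by simpa using (hasDerivAt_id s).const_sub ε
  have h1 := h0.rpow_const (p := -(n : ℝ) / 2) (Or.inl hτ.ne')
  have h2 : HasDerivAt (fun s => -σ / (4 * (ε - s))) _ s :=
    (hasDerivAt_const s (-σ)).div (h0.const_mul 4) (by positivity)
  refine (h1.mul h2.exp).congr_deriv ?_
  rw [Real.rpow_sub_one hτ.ne']
  field_simp
  ring

lemma cutoffProfile_eq_zero {n : ℕ} {ε : ℝ} (hε : 0 < ε) {z : ℝ × ℝ}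
    (hz : ¬ (z.1 ≤ 1 ∧ -1 ≤ z.2 ∧ z.2 ≤ 0)) : cutoffProfile n ε z = 0 := by
  unfold cutoffProfile
  by_cases h1 : z.1 ≤ 1
  · by_cases h2 : -1 ≤ z.2
    · have h3 : 0 < z.2 := by
        by_contra h; exact hz ⟨h1, h2, not_lt.1 h⟩
      rw [Real.smoothTransition.zero_of_nonpos (x := -z.2 / ε)
        (div_nonpos_of_nonpos_of_nonneg (by linarith) hε.le)]
      simp
    · rw [Real.smoothTransition.zero_of_nonpos (x := 2 * z.2 + 2) (by linarith)]
      simp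
  · rw [Real.smoothTransition.zero_of_nonpos (x := 2 - 2 * z.1) (by linarith)]
    simp

lemma contDiff_cutoffProfile (n : ℕ) {ε : ℝ} (hε : 0 < ε) :
    ContDiff ℝ 2 (cutoffProfile n ε) := by
  have hST : ContDiff ℝ 2 Real.smoothTransition := Real.smoothTransition.contDiff (n := 2)
  rw [contDiff_iff_contDiffAt]
  intro z
  by_cases hz : z.2 < ε
  · have hτ : ε - z.2 ≠ 0 := by linarith
    unfold cutoffProfile heatProfile
    have h1 : ContDiffAt ℝ 2 (fun z : ℝ × ℝ => Real.smoothTransition (2 - 2 * z.1)) z :=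
      (hST.comp (by fun_prop)).contDiffAt
    have h2 : ContDiffAt ℝ 2 (fun z : ℝ × ℝ => Real.smoothTransition (2 * z.2 + 2)) z :=
      (hST.comp (by fun_prop)).contDiffAt
    have h3 : ContDiffAt ℝ 2 (fun z : ℝ × ℝ => Real.smoothTransition (-z.2 / ε)) z :=
      (hST.comp (contDiff_snd.neg.div_const ε)).contDiffAt
    have h4 : ContDiffAt ℝ 2 (fun z : ℝ × ℝ => ε - z.2) z := by fun_prop
    have h5 : ContDiffAt ℝ 2 (fun z : ℝ × ℝ => -z.1 / (4 * (ε - z.2))) z :=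
      (contDiffAt_fst.neg).div (contDiffAt_const.mul h4) (by simpa using hτ)
    exact (h1.mul (h2.mul h3)).mul ((h4.rpow_const_of_ne hτ).mul h5.exp)
  · refine (contDiffAt_const (c := (0 : ℝ))).congr_of_eventuallyEq ?_
    have : {w : ℝ × ℝ | 0 < w.2} ∈ nhds z :=
      (isOpen_lt continuous_const continuous_snd).mem_nhds (show 0 < z.2 by linarith)
    filter_upwards [this] with w hw
    exact cutoffProfile_eq_zero hε fun h => by have : 0 < w.2 := hw; linarith

lemma cutoffProfile_nonneg (n : ℕ) {ε : ℝ} (hε : 0 < ε) (z : ℝ × ℝ) :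
    0 ≤ cutoffProfile n ε z := by
  by_cases hz : z.2 < ε
  · exact mul_nonneg (mul_nonneg (Real.smoothTransition.nonneg _)
      (mul_nonneg (Real.smoothTransition.nonneg _) (Real.smoothTransition.nonneg _)))
      (heatProfile_nonneg n hz _)
  · exact (cutoffProfile_eq_zero hε fun h => by linarith).ge

lemma radialHeat_cutoffProfile (n : ℕ) {ε : ℝ} (hε : 0 < ε) {z : ℝ × ℝ} (hz : z.2 < ε) :
    radialHeat n (cutoffProfile n ε) z =
      (2 * deriv Real.smoothTransition (2 * z.2 + 2) * Real.smoothTransition (-z.2 / ε)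
        - Real.smoothTransition (2 * z.2 + 2) * (deriv Real.smoothTransition (-z.2 / ε) / ε))
        * Real.smoothTransition (2 - 2 * z.1) * heatProfile n ε z.1 z.2
      + Real.smoothTransition (2 * z.2 + 2) * Real.smoothTransition (-z.2 / ε)
        * heatProfile n ε z.1 z.2
        * (16 * z.1 * deriv (deriv Real.smoothTransition) (2 - 2 * z.1)
          + 4 * z.1 * deriv Real.smoothTransition (2 - 2 * z.1) / (ε - z.2)
          - 4 * n * deriv Real.smoothTransition (2 - 2 * z.1)) := by
  have hST : ContDiff ℝ 2 Real.smoothTransition := Real.smoothTransition.contDiff (n := 2)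
  have hd : ∀ y, HasDerivAt Real.smoothTransition (deriv Real.smoothTransition y) y := fun y =>
    (hST.differentiable (by simp) y).hasDerivAt
  have hdd : ∀ y, HasDerivAt (deriv Real.smoothTransition)
      (deriv (deriv Real.smoothTransition) y) y := fun y =>
    (((contDiff_succ_iff_deriv (n := 1)).1 hST).2.2.differentiable (by simp) y).hasDerivAt
  have hF := contDiff_cutoffProfile n hε
  have hFd : Differentiable ℝ (cutoffProfile n ε) := hF.differentiable (by simp)
  have hF1 : ContDiff ℝ 1 (fun w => fderiv ℝ (cutoffProfile n ε) w (1, 0)) :=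
    (hF.fderiv_right (m := 1) (by norm_num)).clm_apply contDiff_const
  have hτ : 0 < ε - z.2 := by linarith
  obtain ⟨σ₀, s⟩ := z
  simp only at hτ hz ⊢
  set A := Real.smoothTransition (2 * s + 2) with hA
  set B := Real.smoothTransition (-s / ε) with hB
  have hlin : ∀ σ : ℝ, HasDerivAt (fun σ : ℝ => 2 - 2 * σ) (-2) σ := fun σ => by
    simpa using ((hasDerivAt_id σ).const_mul 2).const_sub 2
  have hχ : ∀ σ, HasDerivAt (fun σ => Real.smoothTransition (2 - 2 * σ))
      (deriv Real.smoothTransition (2 - 2 * σ) * (-2)) σ := fun σ =>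
    HasDerivAt.comp (h₂ := Real.smoothTransition) σ (hd (2 - 2 * σ)) (hlin σ)
  have hχ' : ∀ σ, HasDerivAt (fun σ => deriv Real.smoothTransition (2 - 2 * σ))
      (deriv (deriv Real.smoothTransition) (2 - 2 * σ) * (-2)) σ := fun σ =>
    HasDerivAt.comp (h₂ := deriv Real.smoothTransition) σ (hdd (2 - 2 * σ)) (hlin σ)
  have hH := fun σ => hasDerivAt_heatProfile_left n ε σ s
  have e1 : ∀ σ, fderiv ℝ (cutoffProfile n ε) (σ, s) (1, 0)
      = (A * B) * ((deriv Real.smoothTransition (2 - 2 * σ) * (-2)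
        + Real.smoothTransition (2 - 2 * σ) * (-1 / (4 * (ε - s)))) * heatProfile n ε σ s) := by
    intro σ
    refine fderiv_apply_one_zero (hFd _) ?_
    refine (((hχ σ).mul_const (A * B)).mul (hH σ)).congr_deriv ?_
    ring
  have e11 : fderiv ℝ (fun w => fderiv ℝ (cutoffProfile n ε) w (1, 0)) (σ₀, s) (1, 0)
      = (A * B) * (((deriv (deriv Real.smoothTransition) (2 - 2 * σ₀) * 4
          + (deriv Real.smoothTransition (2 - 2 * σ₀) * (-2)) * (-1 / (4 * (ε - s))))
            * heatProfile n ε σ₀ s)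
        + (deriv Real.smoothTransition (2 - 2 * σ₀) * (-2)
        + Real.smoothTransition (2 - 2 * σ₀) * (-1 / (4 * (ε - s))))
          * (-1 / (4 * (ε - s)) * heatProfile n ε σ₀ s)) := by
    refine fderiv_apply_one_zero (hF1.differentiable (by simp) _) ?_
    simp only [e1]
    refine ((((((hχ' σ₀).mul_const (-2)).add ((hχ σ₀).mul_const (-1 / (4 * (ε - s))))).mul
      (hH σ₀))).const_mul (A * B)).congr_deriv ?_
    simp only [Pi.add_apply]
    ring
  have e2 : fderiv ℝ (cutoffProfile n ε) (σ₀, s) (0, 1)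
      = Real.smoothTransition (2 - 2 * σ₀) * (((deriv Real.smoothTransition (2 * s + 2) * 2) * B
          + A * (deriv Real.smoothTransition (-s / ε) * (-1 / ε))) * heatProfile n ε σ₀ s
        + A * B * ((n / (2 * (ε - s)) - σ₀ / (4 * (ε - s) ^ 2)) * heatProfile n ε σ₀ s)) := by
    refine fderiv_apply_zero_one (hFd _) ?_
    have l1 : HasDerivAt (fun s : ℝ => 2 * s + 2) 2 s := by
      simpa using ((hasDerivAt_id s).const_mul 2).add_const 2
    have l2 : HasDerivAt (fun s : ℝ => -s / ε) (-1 / ε) s := (hasDerivAt_id s).neg.div_const ε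
    have hA' := (hd (2 * s + 2)).comp s l1
    have hB' := (hd (-s / ε)).comp s l2
    refine (((hA'.mul hB').const_mul (Real.smoothTransition (2 - 2 * σ₀))).mul
      (hasDerivAt_heatProfile_right n hz)).congr_deriv ?_
    simp only [Pi.mul_apply, Function.comp_apply, ← hA, ← hB]
    ring
  rw [radialHeat]
  simp only [e1, e11, e2]
  field_simp
  ring

lemma rpow_mul_exp_neg_le {k b : ℝ} (hk : 0 < k) (hb : 0 ≤ b) :
    b ^ k * Real.exp (-(b / 8)) ≤ (8 * k) ^ k := by
  have h8 : 0 < 8 * k := by positivity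
  have h1 : b / (8 * k) ≤ Real.exp (b / (8 * k)) := by
    linarith [Real.add_one_le_exp (b / (8 * k))]
  have h2 : (b / (8 * k)) ^ k ≤ Real.exp (b / 8) := by
    calc (b / (8 * k)) ^ k ≤ Real.exp (b / (8 * k)) ^ k :=
          Real.rpow_le_rpow (by positivity) h1 hk.le
      _ = Real.exp (b / 8) := by rw [← Real.exp_mul]; congr 1; field_simp
  rw [Real.div_rpow hb h8.le, div_le_iff₀ (by positivity)] at h2
  rw [Real.exp_neg, ← div_eq_mul_inv, div_le_iff₀ (Real.exp_pos _)]
  linarith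

lemma exists_heatProfile_le (n : ℕ) (hn : 0 < n) : ∃ B : ℝ, 0 ≤ B ∧
    (∀ ε σ s : ℝ, s < ε → 1 / 2 ≤ σ →
      heatProfile n ε σ s ≤ B ∧ heatProfile n ε σ s / (ε - s) ≤ B) ∧
    (∀ ε σ s : ℝ, 1 / 2 ≤ ε - s → 0 ≤ σ → heatProfile n ε σ s ≤ B) := by
  have hn' : (0 : ℝ) < n := by exact_mod_cast hn
  have hb1 : 0 ≤ (8 * ((n : ℝ) / 2)) ^ ((n : ℝ) / 2) := by positivity
  have hb2 : 0 ≤ (8 * ((n : ℝ) / 2 + 1)) ^ ((n : ℝ) / 2 + 1) := by positivity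
  have hb3 : 0 ≤ (2 : ℝ) ^ ((n : ℝ) / 2) := by positivity
  have hpow : ∀ τ : ℝ, 0 < τ → τ ^ (-(n : ℝ) / 2) = τ⁻¹ ^ ((n : ℝ) / 2) := fun τ hτ => by
    rw [neg_div, Real.rpow_neg hτ.le, Real.inv_rpow hτ.le]
  refine ⟨(8 * ((n : ℝ) / 2)) ^ ((n : ℝ) / 2) + (8 * ((n : ℝ) / 2 + 1)) ^ ((n : ℝ) / 2 + 1)
    + 2 ^ ((n : ℝ) / 2), by positivity, ?_, ?_⟩
  · intro ε σ s hs hσ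
    have hτ : 0 < ε - s := by linarith
    have hle : heatProfile n ε σ s
        ≤ (ε - s)⁻¹ ^ ((n : ℝ) / 2) * Real.exp (-((ε - s)⁻¹ / 8)) := by
      unfold heatProfile
      rw [hpow _ hτ]
      have : -σ / (4 * (ε - s)) ≤ -((ε - s)⁻¹ / 8) := by
        rw [neg_div, neg_le_neg_iff, inv_eq_one_div, div_div, div_le_div_iff₀ (by positivity)
          (by positivity)]
        nlinarith
      gcongr
    have h1 := rpow_mul_exp_neg_le (k := (n : ℝ) / 2) (by positivity) (inv_pos.2 hτ).le
    have h2 := rpow_mul_exp_neg_le (k := (n : ℝ) / 2 + 1) (by positivity) (inv_pos.2 hτ).le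
    rw [Real.rpow_add_one (inv_pos.2 hτ).ne'] at h2
    constructor
    · linarith
    · have h3 := mul_le_mul_of_nonneg_right hle (inv_pos.2 hτ).le
      rw [div_eq_mul_inv]
      linarith
  · intro ε σ s hs hσ
    have hτ : 0 < ε - s := by linarith
    have : heatProfile n ε σ s ≤ 2 ^ ((n : ℝ) / 2) * 1 := by
      unfold heatProfile
      rw [hpow _ hτ]
      have h1 : (ε - s)⁻¹ ≤ 2 := by
        rw [inv_le_comm₀ hτ (by norm_num)]; linarith
      have h2 : Real.exp (-σ / (4 * (ε - s))) ≤ 1 := by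
        rw [Real.exp_le_one_iff]
        exact div_nonpos_of_nonpos_of_nonneg (by linarith) (by positivity)
      gcongr
    linarith

lemma deriv_smoothTransition_nonneg (y : ℝ) : 0 ≤ deriv Real.smoothTransition y :=
  Real.smoothTransition.monotone.deriv_nonneg

lemma deriv_smoothTransition_of_one_lt {y : ℝ} (hy : 1 < y) :
    deriv Real.smoothTransition y = 0 := by
  have : Real.smoothTransition =ᶠ[nhds y] fun _ => 1 := by
    filter_upwards [lt_mem_nhds hy] with w hw using Real.smoothTransition.one_of_one_le hw.le
  rw [this.deriv_eq]; simp

lemma deriv_deriv_smoothTransition_of_one_lt {y : ℝ} (hy : 1 < y) :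
    deriv (deriv Real.smoothTransition) y = 0 := by
  have : deriv Real.smoothTransition =ᶠ[nhds y] fun _ => 0 := by
    filter_upwards [lt_mem_nhds hy] with w hw using deriv_smoothTransition_of_one_lt hw
  rw [this.deriv_eq]; simp

lemma continuous_deriv_smoothTransition : Continuous (deriv Real.smoothTransition) :=
  (Real.smoothTransition.contDiff (n := 1)).continuous_deriv (by simp)

lemma continuous_deriv_deriv_smoothTransition :
    Continuous (deriv (deriv Real.smoothTransition)) :=
  ((contDiff_succ_iff_deriv (n := 1)).1
    (Real.smoothTransition.contDiff (n := 2))).2.2.continuous_deriv (by simp)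

lemma exists_deriv_smoothTransition_bounds : ∃ M : ℝ, 0 ≤ M ∧ ∀ y, 0 ≤ y → y ≤ 1 →
    |deriv Real.smoothTransition y| ≤ M ∧ |deriv (deriv Real.smoothTransition) y| ≤ M := by
  obtain ⟨M₁, h₁⟩ := (isCompact_Icc (a := (0 : ℝ)) (b := 1)).exists_bound_of_continuousOn
    continuous_deriv_smoothTransition.continuousOn
  obtain ⟨M₂, h₂⟩ := (isCompact_Icc (a := (0 : ℝ)) (b := 1)).exists_bound_of_continuousOn
    continuous_deriv_deriv_smoothTransition.continuousOn
  refine ⟨max (max M₁ M₂) 0, le_max_right _ _, fun y h0 h1 => ⟨?_, ?_⟩⟩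
  · exact (h₁ y ⟨h0, h1⟩).trans ((le_max_left _ _).trans (le_max_left _ _))
  · exact (h₂ y ⟨h0, h1⟩).trans ((le_max_right _ _).trans (le_max_left _ _))

lemma exists_half_le_deriv_smoothTransition : ∃ α β : ℝ, 0 ≤ α ∧ α < β ∧ β ≤ 1 ∧
    ∀ y, α ≤ y → y ≤ β → 1 / 2 ≤ deriv Real.smoothTransition y := by
  obtain ⟨a, ha, hda⟩ := exists_deriv_eq_slope Real.smoothTransition (zero_lt_one (α := ℝ))
    Real.smoothTransition.continuous.continuousOn
    ((Real.smoothTransition.contDiff (n := 1)).differentiable (by simp)).differentiableOn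
  have hda' : deriv Real.smoothTransition a = 1 := by
    rw [hda, Real.smoothTransition.one, Real.smoothTransition.zero]; norm_num
  have hnear : ∀ᶠ y in nhds a, 1 / 2 < deriv Real.smoothTransition y ∧ y < 1 := by
    refine Filter.Eventually.and ?_ (gt_mem_nhds ha.2)
    exact continuous_deriv_smoothTransition.continuousAt.eventually
      (lt_mem_nhds (by rw [hda']; norm_num))
  obtain ⟨δ, hδ, h⟩ := Metric.eventually_nhds_iff.1 hnear
  have hmem : ∀ y, a ≤ y → y ≤ a + δ / 2 → 1 / 2 < deriv Real.smoothTransition y ∧ y < 1 := by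
    intro y h1 h2
    refine h ?_
    rw [Real.dist_eq, abs_of_nonneg (by linarith)]; linarith
  exact ⟨a, a + δ / 2, ha.1.le, by linarith, (hmem _ (by linarith) le_rfl).2.le,
    fun y h1 h2 => (hmem y h1 h2).1.le⟩

lemma heatProfile_ge (n : ℕ) {ε σ s : ℝ} (hε : 0 < ε) (hσ : σ ≤ ε) (hs : s ≤ 0) (hs' : -ε ≤ s) :
    (√2 ^ n)⁻¹ * Real.exp (-1 / 4) / √ε ^ n ≤ heatProfile n ε σ s := by
  have hτ : 0 < ε - s := by linarith
  have h1 : (√2 ^ n)⁻¹ / √ε ^ n ≤ (ε - s) ^ (-(n : ℝ) / 2) := by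
    have : (ε - s) ^ (-(n : ℝ) / 2) = (√(ε - s) ^ n)⁻¹ := by
      rw [neg_div, Real.rpow_neg hτ.le, Real.sqrt_eq_rpow, ← Real.rpow_natCast, ← Real.rpow_mul
        hτ.le]
      congr 2; ring
    rw [this, div_eq_mul_inv, ← mul_inv, ← mul_pow, ← Real.sqrt_mul (by norm_num)]
    gcongr
    linarith
  have h2 : Real.exp (-1 / 4) ≤ Real.exp (-σ / (4 * (ε - s))) := by
    rw [Real.exp_le_exp, div_le_div_iff₀ (by norm_num) (by positivity)]
    linarith
  unfold heatProfile
  rw [mul_div_right_comm]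
  gcongr

lemma exists_radialHeat_cutoffProfile_le (n : ℕ) (hn : 0 < n) :
    ∃ C c α β : ℝ, 0 ≤ C ∧ 0 < c ∧ 0 ≤ α ∧ α < β ∧ β ≤ 1 ∧ ∀ ε, 0 < ε → ε ≤ 1 / 4 →
      (∀ z : ℝ × ℝ, 0 ≤ z.1 → z.1 ≤ 1 → -1 ≤ z.2 → z.2 ≤ 0 →
        radialHeat n (cutoffProfile n ε) z ≤ C) ∧
      (∀ z : ℝ × ℝ, 0 ≤ z.1 → z.1 ≤ ε → -(ε * β) ≤ z.2 → z.2 ≤ -(ε * α) →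
        radialHeat n (cutoffProfile n ε) z ≤ C - c / (ε * √ε ^ n)) := by
  obtain ⟨B, hB0, hB1, hB2⟩ := exists_heatProfile_le n hn
  obtain ⟨M, hM0, hM⟩ := exists_deriv_smoothTransition_bounds
  obtain ⟨α, β, hα, hαβ, hβ, hhalf⟩ := exists_half_le_deriv_smoothTransition
  have key : ∀ ε, 0 < ε → ε ≤ 1 / 4 → ∀ z : ℝ × ℝ, 0 ≤ z.1 → z.1 ≤ 1 → -1 ≤ z.2 → z.2 ≤ 0 →
      radialHeat n (cutoffProfile n ε) z ≤ 2 * M * B + (20 + 4 * n) * M * B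
        - Real.smoothTransition (2 * z.2 + 2) * (deriv Real.smoothTransition (-z.2 / ε) / ε)
          * Real.smoothTransition (2 - 2 * z.1) * heatProfile n ε z.1 z.2 := by
    intro ε hε hε4 z hz0 hz1 hs0 hs1
    have hzε : z.2 < ε := by linarith
    have hτ : 0 < ε - z.2 := by linarith
    have hH := heatProfile_nonneg n hzε z.1
    have hst0 := Real.smoothTransition.nonneg
    have hst1 := Real.smoothTransition.le_one
    rw [radialHeat_cutoffProfile n hε hzε]
    have hinit : 2 * deriv Real.smoothTransition (2 * z.2 + 2) * Real.smoothTransition (-z.2 / ε)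
        * Real.smoothTransition (2 - 2 * z.1) * heatProfile n ε z.1 z.2 ≤ 2 * M * B := by
      by_cases hs : z.2 ≤ -1 / 2
      · have h1 := (le_abs_self _).trans (hM (2 * z.2 + 2) (by linarith) (by linarith)).1
        have h2 := hB2 ε z.1 z.2 (by linarith) hz0
        have h3 := deriv_smoothTransition_nonneg (2 * z.2 + 2)
        have h4 := hst0 (-z.2 / ε)
        have h5 := hst1 (-z.2 / ε)
        have h6 := hst0 (2 - 2 * z.1)
        have h7 := hst1 (2 - 2 * z.1)
        generalize Real.smoothTransition (-z.2 / ε) = A₁ at h4 h5 ⊢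
        generalize Real.smoothTransition (2 - 2 * z.1) = A₂ at h6 h7 ⊢
        calc _ ≤ 2 * M * 1 * 1 * B := by gcongr
          _ = _ := by ring
      · rw [deriv_smoothTransition_of_one_lt (by linarith)]
        simp only [mul_zero, zero_mul]; positivity
    have hcut : Real.smoothTransition (2 * z.2 + 2) * Real.smoothTransition (-z.2 / ε)
        * heatProfile n ε z.1 z.2
        * (16 * z.1 * deriv (deriv Real.smoothTransition) (2 - 2 * z.1)
          + 4 * z.1 * deriv Real.smoothTransition (2 - 2 * z.1) / (ε - z.2)
          - 4 * n * deriv Real.smoothTransition (2 - 2 * z.1)) ≤ (20 + 4 * n) * M * B := by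
      by_cases hσ : 1 / 2 ≤ z.1
      · obtain ⟨h1, h2⟩ := hM (2 - 2 * z.1) (by linarith) (by linarith)
        obtain ⟨h3, h4⟩ := hB1 ε z.1 z.2 hzε hσ
        set D := deriv Real.smoothTransition (2 - 2 * z.1)
        set D' := deriv (deriv Real.smoothTransition) (2 - 2 * z.1)
        set H := heatProfile n ε z.1 z.2
        have e : Real.smoothTransition (2 * z.2 + 2) * Real.smoothTransition (-z.2 / ε) * H
            * (16 * z.1 * D' + 4 * z.1 * D / (ε - z.2) - 4 * n * D)
            = (Real.smoothTransition (2 * z.2 + 2) * Real.smoothTransition (-z.2 / ε))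
              * (16 * z.1 * D' * H + 4 * z.1 * D * (H / (ε - z.2)) + 4 * n * (-D) * H) := by ring
        rw [e]
        have hHτ : 0 ≤ H / (ε - z.2) := div_nonneg hH hτ.le
        have t1 : 16 * z.1 * D' * H ≤ 16 * 1 * M * B := by
          calc _ ≤ 16 * z.1 * |D'| * H := by gcongr; exact le_abs_self _
            _ ≤ _ := by gcongr
        have t2 : 4 * z.1 * D * (H / (ε - z.2)) ≤ 4 * 1 * M * B := by
          calc _ ≤ 4 * z.1 * |D| * (H / (ε - z.2)) := by gcongr; exact le_abs_self _
            _ ≤ _ := by gcongr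
        have t3 : 4 * n * (-D) * H ≤ 4 * n * M * B := by
          calc _ ≤ 4 * n * |D| * H := by gcongr; exact neg_le_abs _
            _ ≤ _ := by gcongr
        have hw0 : 0 ≤ Real.smoothTransition (2 * z.2 + 2) * Real.smoothTransition (-z.2 / ε) :=
          mul_nonneg (hst0 _) (hst0 _)
        have hw1 : Real.smoothTransition (2 * z.2 + 2) * Real.smoothTransition (-z.2 / ε) ≤ 1 :=
          mul_le_one₀ (hst1 _) (hst0 _) (hst1 _)
        have hbd : 0 ≤ (20 + 4 * n) * M * B := by positivity
        calc _ ≤ (Real.smoothTransition (2 * z.2 + 2) * Real.smoothTransition (-z.2 / ε))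
              * ((20 + 4 * n) * M * B) := by
              refine mul_le_mul_of_nonneg_left ?_ hw0
              linarith
          _ ≤ 1 * ((20 + 4 * n) * M * B) := by gcongr
          _ = _ := one_mul _
      · rw [deriv_smoothTransition_of_one_lt (by linarith),
          deriv_deriv_smoothTransition_of_one_lt (by linarith)]
        simp only [mul_zero, zero_div, add_zero, sub_zero]; positivity
    linarith
  refine ⟨2 * M * B + (20 + 4 * n) * M * B, 1 / 2 * ((√2 ^ n)⁻¹ * Real.exp (-1 / 4)), α, β,
    by positivity, by positivity, hα, hαβ, hβ, fun ε hε hε4 => ⟨?_, ?_⟩⟩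
  · intro z hz0 hz1 hs0 hs1
    have h := key ε hε hε4 z hz0 hz1 hs0 hs1
    have : 0 ≤ Real.smoothTransition (2 * z.2 + 2) * (deriv Real.smoothTransition (-z.2 / ε) / ε)
          * Real.smoothTransition (2 - 2 * z.1) * heatProfile n ε z.1 z.2 :=
      mul_nonneg (mul_nonneg (mul_nonneg (Real.smoothTransition.nonneg _)
        (div_nonneg (deriv_smoothTransition_nonneg _) hε.le)) (Real.smoothTransition.nonneg _))
        (heatProfile_nonneg n (by linarith) _)
    linarith
  · intro z hz0 hz1 hs0 hs1
    have hεβ : ε * β ≤ ε := by nlinarith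
    have hεα : 0 ≤ ε * α := by positivity
    have h := key ε hε hε4 z hz0 (by linarith) (by linarith) (by linarith)
    rw [Real.smoothTransition.one_of_one_le (x := 2 * z.2 + 2) (by linarith),
      Real.smoothTransition.one_of_one_le (x := 2 - 2 * z.1) (by linarith)] at h
    have h1 := hhalf (-z.2 / ε) (by rw [le_div_iff₀ hε]; linarith)
      (by rw [div_le_iff₀ hε]; linarith)
    have h2 := heatProfile_ge n hε hz1 (s := z.2) (by linarith) (by linarith)
    have h3 : 1 / 2 * ((√2 ^ n)⁻¹ * Real.exp (-1 / 4)) / (ε * √ε ^ n)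
        ≤ 1 * (deriv Real.smoothTransition (-z.2 / ε) / ε) * 1 * heatProfile n ε z.1 z.2 := by
      calc _ = 1 * ((1 / 2) / ε) * 1 * ((√2 ^ n)⁻¹ * Real.exp (-1 / 4) / √ε ^ n) := by
            field_simp
        _ ≤ _ := by gcongr
    linarith

/-- Local boundedness of the square of a weak solution in a cylinder whose closure lies in the
domain. -/
lemma exists_sq_le_integral_of_isCaloricOn (n : ℕ) (hn : 0 < n) : ∃ C : ℝ, 0 < C ∧
    ∀ V : En n → ℝ, (∀ x, 0 ≤ V x) → ∀ (u : En n → ℝ → ℝ) (S : Set (En n × ℝ)), IsOpen S →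
      ContDiffOn ℝ 1 (fun p : En n × ℝ => u p.1 p.2) S → IsCaloricOn n V u S →
      ∀ (x : En n) (t r : ℝ), 0 < r → closedBall x r ×ˢ Icc (t - r ^ 2) t ⊆ S →
        u x t ^ 2 ≤ C * ((r ^ (n + 2))⁻¹ *
          ∫ p in closedBall x r ×ˢ Icc (t - r ^ 2) t, u p.1 p.2 ^ 2) := by
  obtain ⟨C, c, α, β, hC, hc, hα, hαβ, hβ, hprof⟩ := exists_radialHeat_cutoffProfile_le n hn
  have : Nonempty (Fin n) := ⟨⟨0, hn⟩⟩
  set ω := (volume (ball (0 : En n) 1)).toReal with hω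
  have hω0 : 0 < ω := ENNReal.toReal_pos (measure_ball_pos _ _ one_pos).ne'
    measure_ball_lt_top.ne
  have hβα : 0 < β - α := sub_pos.2 hαβ
  refine ⟨(C + 1) / (c * ω * (β - α)), by positivity, ?_⟩
  intro V hV u S hS hu hcal x t r hr hQS
  set w : En n × ℝ → ℝ := fun p => u p.1 p.2 ^ 2
  set Q : Set (En n × ℝ) := closedBall x r ×ˢ Icc (t - r ^ 2) t with hQ
  have hr2 : 0 < r ^ 2 := by positivity
  have hQc : IsCompact Q := (isCompact_closedBall x r).prod isCompact_Icc
  have hQm : MeasurableSet Q := hQc.isClosed.measurableSet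
  have hwc : ContinuousOn w S := (hu.continuousOn).pow 2
  have hwQ : IntegrableOn w Q := (hwc.mono hQS).integrableOn_compact hQc
  have hw0 : ∀ p, 0 ≤ w p := fun p => sq_nonneg _
  have hI0 : 0 ≤ ∫ p in Q, w p := integral_nonneg hw0
  have hxQ : (x, t) ∈ Q := ⟨mem_closedBall_self hr.le, by simp [hr2.le], le_rfl⟩
  refine le_of_forall_lt_imp_le_of_dense fun m hm => ?_
  rcases lt_or_ge m 0 with hm0 | hm0
  · exact hm0.le.trans (by positivity)
  suffices h : m * (c * ω * (β - α) * r ^ (n + 2)) ≤ C * ∫ p in Q, w p by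
    rw [← mul_assoc, ← div_eq_mul_inv, div_div, div_mul_eq_mul_div, le_div_iff₀ (by positivity)]
    linarith
  have hnear : ∀ᶠ p in nhds (x, t), m < w p :=
    (hwc.continuousAt (hS.mem_nhds (hQS hxQ))).eventually (lt_mem_nhds hm)
  obtain ⟨δ, hδ, hball⟩ := Metric.eventually_nhds_iff.1 hnear
  have hsmall : ∀ᶠ ε : ℝ in nhdsWithin 0 (Ioi 0),
      0 < ε ∧ ε < 1 / 4 ∧ r * √ε < δ ∧ r ^ 2 * ε < δ := by
    have hcont : ∀ f : ℝ → ℝ, Continuous f → ∀ b, f 0 < b →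
        ∀ᶠ ε : ℝ in nhdsWithin 0 (Ioi 0), f ε < b := fun f hf b hb =>
      (hf.continuousAt.eventually (gt_mem_nhds hb)).filter_mono nhdsWithin_le_nhds
    refine (eventually_mem_nhdsWithin).and ((hcont id continuous_id _ (by norm_num)).and
      ((hcont (fun ε => r * √ε) (by fun_prop) _ (by simpa using hδ)).and
        (hcont (fun ε => r ^ 2 * ε) (by fun_prop) _ (by simpa using hδ))))
  obtain ⟨ε, hε, hε4, hε1, hε2⟩ := hsmall.exists
  obtain ⟨hle, hle'⟩ := hprof ε hε hε4.le
  set a := (r ^ 2)⁻¹ with ha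
  have ha0 : 0 < a := inv_pos.2 hr2
  set N := c / (ε * √ε ^ n) with hN
  have hsε : 0 < √ε := Real.sqrt_pos.2 hε
  have hN0 : 0 ≤ N := by positivity
  set φ : En n × ℝ → ℝ := fun p => cutoffProfile n ε (radialCoord x t a p) with hφ
  have hφ2 : ContDiff ℝ 2 φ := (contDiff_cutoffProfile n hε).comp (contDiff_radialCoord x t a)
  have hz0 : ∀ p, 0 ≤ (radialCoord x t a p).1 := fun p => by unfold radialCoord; positivity
  have hmemQ : ∀ p, p ∈ Q ↔ (radialCoord x t a p).1 ≤ 1 ∧ -1 ≤ (radialCoord x t a p).2 ∧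
      (radialCoord x t a p).2 ≤ 0 := by
    intro p
    have e1 : a * ‖p.1 - x‖ ^ 2 ≤ 1 ↔ ‖p.1 - x‖ ≤ r := by
      rw [ha, inv_mul_le_iff₀ hr2, mul_one, sq_le_sq₀ (norm_nonneg _) hr.le]
    have e2 : -1 ≤ a * (p.2 - t) ↔ t - r ^ 2 ≤ p.2 := by
      rw [ha, le_inv_mul_iff₀ hr2]
      constructor <;> intro h <;> linarith
    have e3 : a * (p.2 - t) ≤ 0 ↔ p.2 ≤ t := by
      rw [ha, inv_mul_le_iff₀ hr2]
      constructor <;> intro h <;> linarith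
    rw [hQ, mem_prod, mem_closedBall, dist_eq_norm, mem_Icc, radialCoord]
    simp only [e1, e2, e3]
  have hφ0 : ∀ p ∉ Q, φ p = 0 := fun p hp =>
    cutoffProfile_eq_zero hε fun h => hp ((hmemQ p).2 h)
  have hLeq : ∀ p, backwardHeat φ p
      = a * radialHeat n (cutoffProfile n ε) (radialCoord x t a p) :=
    backwardHeat_comp_radialCoord x t a (contDiff_cutoffProfile n hε)
  obtain ⟨hint, hnn⟩ := hcal.integral_sq_mul_backwardHeat_nonneg hV hS hu hQc hQS hφ2
    (fun p => cutoffProfile_nonneg n hε _) hφ0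
  set R : Set (En n × ℝ) :=
    ball x (r * √ε) ×ˢ Icc (t - r ^ 2 * ε * β) (t - r ^ 2 * ε * α) with hR
  have hRm : MeasurableSet R := measurableSet_ball.prod measurableSet_Icc
  have hβ0 : 0 < β := hα.trans_lt hαβ
  have hRz : ∀ p ∈ R, (radialCoord x t a p).1 ≤ ε ∧ -(ε * β) ≤ (radialCoord x t a p).2 ∧
      (radialCoord x t a p).2 ≤ -(ε * α) := by
    rintro p ⟨h1, h2, h3⟩
    rw [mem_ball, dist_eq_norm] at h1
    simp only [radialCoord]
    refine ⟨?_, ?_, ?_⟩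
    · rw [ha, inv_mul_le_iff₀ hr2]
      calc ‖p.1 - x‖ ^ 2 ≤ (r * √ε) ^ 2 := by gcongr
        _ = r ^ 2 * ε := by rw [mul_pow, Real.sq_sqrt hε.le]
    · rw [ha, le_inv_mul_iff₀ hr2]; linarith
    · rw [ha, inv_mul_le_iff₀ hr2]; linarith
  have hRQ : R ⊆ Q := by
    intro p hp
    obtain ⟨h1, h2, h3⟩ := hRz p hp
    have : 0 ≤ ε * α := by positivity
    have : ε * β ≤ ε := mul_le_of_le_one_right hε.le hβ
    exact (hmemQ p).2 ⟨by linarith, by linarith, by linarith⟩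
  have hRw : ∀ p ∈ R, m ≤ w p := by
    rintro p ⟨h1, h2, h3⟩
    refine (hball ?_).le
    rw [Prod.dist_eq, max_lt_iff]
    refine ⟨(mem_ball.1 h1).trans hε1, ?_⟩
    have e1 : 0 ≤ r ^ 2 * ε * α := by positivity
    have e2 : r ^ 2 * ε * β ≤ r ^ 2 * ε := mul_le_of_le_one_right (by positivity) hβ
    rw [Real.dist_eq, abs_lt]
    constructor <;> dsimp only <;> linarith
  have hvol : (volume R).toReal = (r * √ε) ^ n * ω * (r ^ 2 * ε * (β - α)) := by
    rw [hR, Measure.volume_eq_prod, Measure.prod_prod, ENNReal.toReal_mul, Real.volume_Icc,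
      Measure.addHaar_ball _ _ (by positivity), ENNReal.toReal_mul,
      ENNReal.toReal_ofReal (by positivity), finrank_euclideanSpace_fin,
      ENNReal.toReal_ofReal]
    · ring
    · have : 0 ≤ r ^ 2 * ε * (β - α) := by positivity
      linarith
  have hRfin : volume R ≠ ⊤ := (measure_mono hRQ).trans_lt hQc.measure_lt_top |>.ne
  have hi1 : Integrable (fun p => a * C * Q.indicator w p) :=
    (hwQ.integrable_indicator hQm).const_mul _
  have hi2 : Integrable (fun p => a * (N * m) * R.indicator (fun _ => (1 : ℝ)) p) :=
    ((integrableOn_const hRfin).integrable_indicator hRm).const_mul _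
  have hpt : ∀ p, w p * backwardHeat φ p
      ≤ a * C * Q.indicator w p - a * (N * m) * R.indicator (fun _ => (1 : ℝ)) p := by
    intro p
    by_cases hpQ : p ∈ Q
    · obtain ⟨q1, q2, q3⟩ := (hmemQ p).1 hpQ
      rw [indicator_of_mem hpQ, hLeq]
      by_cases hpR : p ∈ R
      · obtain ⟨s1, s2, s3⟩ := hRz p hpR
        rw [indicator_of_mem hpR]
        have h1 := hle' _ (hz0 p) s1 s2 s3
        calc _ ≤ w p * (a * (C - N)) := by
              have := hw0 p
              gcongr
          _ = a * C * w p - a * (N * w p) := by ring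
          _ ≤ a * C * w p - a * (N * m) * 1 := by
              have := hRw p hpR
              rw [mul_one]
              gcongr
      · rw [indicator_of_notMem hpR]
        have h1 := hle _ (hz0 p) q1 q2 q3
        calc _ ≤ w p * (a * C) := by
              have := hw0 p
              gcongr
          _ = _ := by ring
    · rw [indicator_of_notMem hpQ, indicator_of_notMem (fun h => hpQ (hRQ h)),
        backwardHeat_eq_zero_of_notMem hQc.isClosed hφ0 p hpQ]
      simp
  have hfin := hnn.trans (integral_mono hint (hi1.sub hi2) hpt)
  simp only [Pi.sub_apply] at hfin
  rw [integral_sub hi1 hi2, integral_const_mul, integral_const_mul, integral_indicator hQm,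
    integral_indicator hRm, setIntegral_const, smul_eq_mul, mul_one, Measure.real, hvol] at hfin
  have hid : N * m * ((r * √ε) ^ n * ω * (r ^ 2 * ε * (β - α)))
      = m * (c * ω * (β - α) * r ^ (n + 2)) := by
    rw [hN, mul_pow]
    field_simp
    ring
  have hprod : 0 ≤ a * (C * (∫ p in Q, w p) - m * (c * ω * (β - α) * r ^ (n + 2))) := by
    rw [← hid]; linarith
  linarith [(mul_nonneg_iff_of_pos_left ha0).1 hprod]

/-- Lemma 2.6: local boundedness of weak solutions on parabolic cubes. -/
theorem statement3 (n : ℕ) (hn : 3 ≤ n) :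
    ∃ C : ℝ, 0 < C ∧
      ∀ (q : ℝ), (n : ℝ) / 2 < q →
      ∀ V : En n → ℝ, (∀ x, 0 ≤ V x) →
        LocallyIntegrable (fun y => V y ^ q) volume →
      ∀ (u : En n → ℝ → ℝ) (x₀ : En n) (t₀ r₀ : ℝ), 0 < r₀ →
        ContDiffOn ℝ 1 (fun p : En n × ℝ => u p.1 p.2)
          (ball x₀ r₀ ×ˢ Set.Ioc (t₀ - r₀ ^ 2) t₀) →
        IsCaloricOn n V u (ball x₀ r₀ ×ˢ Set.Ioo (t₀ - r₀ ^ 2) t₀) →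
        ∀ x ∈ ball x₀ (r₀ / 4), ∀ t ∈ Set.Ioc (t₀ - (r₀ / 4) ^ 2) t₀,
          |u x t| ≤ C * (r₀ ^ (-((n : ℝ) + 2)) *
            ∫ s in Set.Ioc (t₀ - (r₀ / 2) ^ 2) t₀,
              ∫ y in ball x₀ (r₀ / 2), (u y s) ^ 2) ^ ((1 : ℝ) / 2) := by
  obtain ⟨A, hA, hmean⟩ := exists_sq_le_integral_of_isCaloricOn n (by omega)
  refine ⟨√(A * 4 ^ (n + 2)), by positivity, ?_⟩
  intro q _ V hV _ u x₀ t₀ r₀ hr hu hcal x hx t ht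
  have hr2 : 0 < r₀ ^ 2 := by positivity
  set D : Set (En n × ℝ) := ball x₀ (r₀ / 2) ×ˢ Ioc (t₀ - (r₀ / 2) ^ 2) t₀ with hD
  have hDint : IntegrableOn (fun p : En n × ℝ => u p.1 p.2 ^ 2) D := by
    have hK : IsCompact (closedBall x₀ (r₀ / 2) ×ˢ Icc (t₀ - (r₀ / 2) ^ 2) t₀) :=
      (isCompact_closedBall _ _).prod isCompact_Icc
    refine IntegrableOn.mono_set (ContinuousOn.integrableOn_compact hK ?_)
      (prod_mono ball_subset_closedBall Ioc_subset_Icc_self)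
    refine (hu.continuousOn.pow 2).mono (prod_mono (closedBall_subset_ball (by linarith)) ?_)
    exact fun s hs => ⟨by nlinarith [hs.1], hs.2⟩
  have hiter : ∫ s in Ioc (t₀ - (r₀ / 2) ^ 2) t₀, ∫ y in ball x₀ (r₀ / 2), u y s ^ 2
      = ∫ p in D, u p.1 p.2 ^ 2 := by
    rw [hD, Measure.volume_eq_prod, ← Measure.prod_restrict, integral_prod_symm]
    rwa [Measure.prod_restrict, ← Measure.volume_eq_prod]
  rw [hiter]
  set J := ∫ p in D, u p.1 p.2 ^ 2 with hJ
  have hJ0 : 0 ≤ J := integral_nonneg fun p => sq_nonneg _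
  have hbefore : ∀ s ∈ Ioo (t₀ - (r₀ / 4) ^ 2) t₀,
      |u x s| ≤ √(A * 4 ^ (n + 2)) * (r₀ ^ (-((n : ℝ) + 2)) * J) ^ ((1 : ℝ) / 2) := by
    intro s hs
    have hsub : ∀ y ∈ closedBall x (r₀ / 4), dist y x₀ < r₀ / 2 := fun y hy => by
      have := dist_triangle y x x₀
      have h1 := mem_closedBall.1 hy
      have h2 := mem_ball.1 hx
      linarith
    have hQS : closedBall x (r₀ / 4) ×ˢ Icc (s - (r₀ / 4) ^ 2) s
        ⊆ ball x₀ r₀ ×ˢ Ioo (t₀ - r₀ ^ 2) t₀ := fun p hp =>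
      ⟨by have := hsub _ hp.1; rw [mem_ball]; linarith,
        by nlinarith [hp.2.1, hs.1], hp.2.2.trans_lt hs.2⟩
    have hQD : closedBall x (r₀ / 4) ×ˢ Icc (s - (r₀ / 4) ^ 2) s ⊆ D := fun p hp =>
      ⟨hsub _ hp.1, by nlinarith [hp.2.1, hs.1], hp.2.2.trans hs.2.le⟩
    have h := hmean V hV u _ (isOpen_ball.prod isOpen_Ioo)
      (hu.mono (prod_mono_right Ioo_subset_Ioc_self)) hcal x s (r₀ / 4) (by positivity) hQS
    have hmono : ∫ p in closedBall x (r₀ / 4) ×ˢ Icc (s - (r₀ / 4) ^ 2) s, u p.1 p.2 ^ 2 ≤ J :=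
      setIntegral_mono_set hDint (Filter.Eventually.of_forall fun p => sq_nonneg _)
        hQD.eventuallyLE
    have hpow : r₀ ^ (-((n : ℝ) + 2)) = (r₀ ^ (n + 2))⁻¹ := by
      rw [Real.rpow_neg hr.le, ← Real.rpow_natCast]; push_cast; rfl
    rw [← Real.sqrt_eq_rpow, ← Real.sqrt_mul (by positivity), hpow]
    refine Real.abs_le_sqrt (h.trans ?_)
    calc _ ≤ A * (((r₀ / 4) ^ (n + 2))⁻¹ * J) := by gcongr
      _ = _ := by rw [div_pow, inv_div]; ring
  rcases ht.2.lt_or_eq with hlt | rfl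
  · exact hbefore t ⟨ht.1, hlt⟩
  · have hx' : x ∈ ball x₀ r₀ := ball_subset_ball (by linarith) hx
    have hcont : ContinuousWithinAt (fun s => u x s) (Iio t) t := by
      have h1 : ContinuousWithinAt (fun s => u x s) (Ioc (t - r₀ ^ 2) t) t :=
        (hu.continuousOn.comp (f := fun s => (x, s)) (by fun_prop)
          (fun s hs => ⟨hx', hs⟩)) t ⟨by linarith, le_rfl⟩
      refine (h1.mono Ioo_subset_Ioc_self).mono_of_mem_nhdsWithin ?_
      exact Ioo_mem_nhdsLT (by linarith)
    refine le_of_tendsto hcont.abs ?_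
    filter_upwards [Ioo_mem_nhdsLT ht.1] with s hs using hbefore s hs
end
end

section
/- Let n ≥ 1, q > 1, and let V ∈ B_q(ℝⁿ) with reverse Hölder constant A. Then there exists ε > 0, depending only on n, q and A, such that V ∈ B_{q+ε}(ℝⁿ); moreover the B_{q+ε} constant of V is controlled in terms of n, q and A. -/
open MeasureTheory Metric Set
open RealInnerProductSpace

noncomputable section

/-- The volume of a ball of radius `r` in `En n`. -/
def ballVol (n : ℕ) (r : ℝ) : ℝ := r ^ n * volume.real (ball (0 : En n) 1)

lemma ballVol_pos (n : ℕ) {r : ℝ} (hr : 0 < r) : 0 < ballVol n r :=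
  mul_pos (pow_pos hr n)
    (ENNReal.toReal_pos (measure_ball_pos volume _ one_pos).ne' measure_ball_lt_top.ne)

lemma ballVol_mul (n : ℕ) (s r : ℝ) : ballVol n (s * r) = s ^ n * ballVol n r := by
  simp only [ballVol, mul_pow, mul_assoc]

lemma volume_real_ball {n : ℕ} (x : En n) {r : ℝ} (hr : 0 < r) :
    volume.real (ball x r) = ballVol n r := by
  have h := Measure.addHaar_ball_of_pos (volume : Measure (En n)) x hr
  rw [measureReal_def, h, ENNReal.toReal_mul, ENNReal.toReal_ofReal (by positivity),
    finrank_euclideanSpace_fin]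
  rfl

lemma closedBall_ae_eq_ball {n : ℕ} (x : En n) {r : ℝ} (hr : 0 < r) :
    closedBall x r =ᵐ[volume] ball x r := by
  rw [← ball_union_sphere]
  exact union_ae_eq_left_of_ae_eq_empty
    (ae_eq_empty.2 (Measure.addHaar_sphere_of_ne_zero volume x hr.ne'))

lemma ae_exists_lt_setIntegral_ball {n : ℕ} {f : En n → ℝ} (hf : LocallyIntegrable f volume)
    {R : ℝ} (hR : 0 < R) :
    ∀ᵐ x, ∀ l < f x, ∃ k : ℕ,
      l * ballVol n (R / 8 ^ k) < ∫ y in ball x (R / 8 ^ k), f y := by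
  filter_upwards [IsUnifLocDoublingMeasure.ae_tendsto_average volume hf 1] with x hx l hl
  have hpos : ∀ k : ℕ, 0 < R / 8 ^ k := fun k => by positivity
  have hlim : Filter.Tendsto (fun k : ℕ => R / 8 ^ k) Filter.atTop (nhdsWithin 0 (Ioi 0)) := by
    refine tendsto_nhdsWithin_iff.2 ⟨?_, Filter.Eventually.of_forall hpos⟩
    have := (tendsto_pow_atTop_nhds_zero_of_lt_one (r := (1 / 8 : ℝ))
      (by norm_num) (by norm_num)).const_mul R
    simpa [div_eq_mul_inv] using this
  have h := hx (fun _ => x) _ hlim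
    (Filter.Eventually.of_forall fun k => mem_closedBall_self (by simpa using (hpos k).le))
  obtain ⟨k, hk⟩ := (h.eventually (lt_mem_nhds hl)).exists
  refine ⟨k, ?_⟩
  rw [setAverage_congr (closedBall_ae_eq_ball x (hpos k)), setAverage_eq, smul_eq_mul,
    volume_real_ball x (hpos k), inv_mul_eq_div, lt_div_iff₀ (ballVol_pos n (hpos k))] at hk
  exact hk

/-- A stopping-time covering estimate: if on each ball where the average of `f` first exceeds `l`
the measure `ν` of the dilated ball is controlled by `ν` of a part of `T`, then `ν {l < f}` is
controlled by `ν T`. -/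
lemma measure_superlevel_le {n : ℕ} {f : En n → ℝ} (hf : LocallyIntegrable f volume)
    {S : Set (En n)} (hS : ∀ x ∉ S, f x = 0) {R l : ℝ} (hR : 0 < R) (hl : 0 < l)
    (hlR : ∀ x ∈ S, ∫ y in ball x R, f y ≤ l * ballVol n R)
    {ν : Measure (En n)} (hν : ν ≪ volume) {T : Set (En n)} (hT : MeasurableSet T)
    {C : ENNReal}
    (h : ∀ x ∈ S, ∀ r, 0 < r → 8 * r ≤ R →
      ∫ y in ball x (8 * r), f y ≤ l * ballVol n (8 * r) →
      l * ballVol n r < ∫ y in ball x r, f y → ν (ball x (8 * r)) ≤ C * ν (ball x r ∩ T)) :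
    ν {x | l < f x} ≤ C * ν T := by
  let P : En n → ℝ → Prop := fun x r => 0 < r ∧ r ≤ R ∧ ν (ball x (8 * r)) ≤ C * ν (ball x r ∩ T)
  have hP : ∀ᵐ x, l < f x → ∃ r, P x r := by
    filter_upwards [ae_exists_lt_setIntegral_ball hf hR] with x hx hlx
    have hxS : x ∈ S := by
      by_contra hxS
      rw [hS x hxS] at hlx
      exact hl.not_gt hlx
    classical
    have hex := hx l hlx
    have hspec := Nat.find_spec hex
    have hmin := fun m => Nat.find_min (m := m) hex
    obtain hk | ⟨k, hk⟩ := Nat.eq_zero_or_eq_succ_pred (Nat.find hex) |>.imp_right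
      fun h => (⟨_, h⟩ : ∃ k, Nat.find hex = k + 1)
    · rw [hk] at hspec
      simp only [pow_zero, div_one] at hspec
      exact absurd (hlR x hxS) hspec.not_ge
    · rw [hk] at hspec
      have hpre := hmin k (by omega)
      have h8 : 8 * (R / 8 ^ (k + 1)) = R / 8 ^ k := by
        rw [pow_succ]; field_simp
      have hle : R / 8 ^ k ≤ R := div_le_self hR.le (one_le_pow₀ (by norm_num))
      have hpos : 0 < R / 8 ^ (k + 1) := by positivity
      refine ⟨R / 8 ^ (k + 1), hpos, by linarith, ?_⟩
      exact h x hxS _ hpos (h8 ▸ hle) (by rw [h8]; exact not_lt.1 hpre) hspec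
  choose! ρ hρ using fun x (hx : ∃ r, P x r) => hx
  obtain ⟨u, hut, hud, hu⟩ := Vitali.exists_disjoint_subfamily_covering_enlargement_closedBall
    {x | ∃ r, P x r} id ρ R (fun a ha => (hρ a ha).2.1) 5 (by norm_num)
  have hpos : ∀ b ∈ u, 0 < ρ b := fun b hb => (hρ b (hut hb)).1
  have hud' : u.PairwiseDisjoint fun b => ball b (ρ b) :=
    hud.mono fun b => ball_subset_closedBall
  have huc : u.Countable := hud'.countable_of_isOpen (fun _ _ => isOpen_ball)
    fun b hb => ⟨b, mem_ball_self (hpos b hb)⟩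
  have hcover : {x | l < f x} ≤ᵐ[ν] ⋃ b ∈ u, ball b (8 * ρ b) := by
    filter_upwards [hν.ae_le hP] with x hx hlx
    have hxt := hx hlx
    obtain ⟨b, hb, hsub⟩ := hu x hxt
    have hxb := hsub (mem_closedBall_self (hρ x hxt).1.le)
    refine mem_biUnion hb ?_
    rw [mem_closedBall] at hxb
    simp only [id] at hxb
    rw [mem_ball]
    have := hpos b hb
    linarith
  have := huc.to_subtype
  calc ν {x | l < f x} ≤ ν (⋃ b ∈ u, ball b (8 * ρ b)) := measure_mono_ae hcover
    _ ≤ ∑' b : u, ν (ball (b : En n) (8 * ρ b)) := measure_biUnion_le ν huc _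
    _ ≤ ∑' b : u, C * ν (ball (b : En n) (ρ b) ∩ T) :=
        ENNReal.tsum_le_tsum fun b => (hρ b (hut b.2)).2.2
    _ = C * ν (⋃ b ∈ u, ball b (ρ b) ∩ T) := by
        rw [ENNReal.tsum_mul_left, measure_biUnion huc
          (hud'.mono fun b => inter_subset_left) fun b _ => measurableSet_ball.inter hT]
    _ ≤ C * ν T := by
        gcongr
        exact iUnion₂_subset fun b _ => inter_subset_right

/-- Geometric decay of the superlevel sets of `f` gives integrability of a power of `f`. -/
lemma lintegral_rpow_le_of_decay {α : Type*} [MeasurableSpace α] {ν : Measure α} {f : α → ℝ}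
    (hfm : Measurable f) (hf : ∀ x, 0 ≤ f x) {l L ε : ℝ} (hl : 0 < l) (hL : 1 < L) (hε : 0 < ε)
    {θ : ENNReal} (h : ∀ t, l ≤ t → ν {x | L * t < f x} ≤ θ * ν {x | t < f x}) :
    ∫⁻ x, ENNReal.ofReal (f x ^ ε) ∂ν ≤ ENNReal.ofReal (l ^ ε) *
      (1 + ENNReal.ofReal (L ^ ε) * (1 - ENNReal.ofReal (L ^ ε) * θ)⁻¹) * ν univ := by
  have hL0 : 0 < L := one_pos.trans hL
  set Λ := ENNReal.ofReal (L ^ ε) with hΛ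
  have hpow : ∀ k : ℕ, ENNReal.ofReal ((L ^ k * l) ^ ε) = Λ ^ k * ENNReal.ofReal (l ^ ε) := by
    intro k
    rw [Real.mul_rpow (by positivity) hl.le, ENNReal.ofReal_mul (by positivity), hΛ,
      ← ENNReal.ofReal_pow (by positivity), ← Real.rpow_natCast, ← Real.rpow_natCast,
      ← Real.rpow_mul hL0.le, ← Real.rpow_mul hL0.le, mul_comm ε]
  have hset : ∀ k : ℕ, MeasurableSet {x | L ^ k * l < f x} := fun k =>
    measurableSet_lt measurable_const hfm
  have hdecay : ∀ k : ℕ, ν {x | L ^ k * l < f x} ≤ θ ^ k * ν univ := by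
    intro k
    induction k with
    | zero => simpa using measure_mono (subset_univ _)
    | succ k ih =>
      calc ν {x | L ^ (k + 1) * l < f x} = ν {x | L * (L ^ k * l) < f x} := by
            rw [pow_succ', mul_assoc]
        _ ≤ θ * ν {x | L ^ k * l < f x} :=
            h _ (le_mul_of_one_le_left hl.le (one_le_pow₀ hL.le))
        _ ≤ θ * (θ ^ k * ν univ) := by gcongr
        _ = θ ^ (k + 1) * ν univ := by rw [pow_succ', mul_assoc]
  have hpt : ∀ x, ENNReal.ofReal (f x ^ ε) ≤ ENNReal.ofReal (l ^ ε) +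
      ∑' k : ℕ, {x | L ^ k * l < f x}.indicator
        (fun _ => Λ ^ (k + 1) * ENNReal.ofReal (l ^ ε)) x := by
    intro x
    have hex : ∃ k : ℕ, f x ≤ L ^ k * l := by
      obtain ⟨k, hk⟩ := pow_unbounded_of_one_lt (f x / l) hL
      exact ⟨k, ((div_lt_iff₀ hl).1 hk).le⟩
    classical
    have hspec := Nat.find_spec hex
    have hmin := fun m => Nat.find_min (m := m) hex
    obtain hk | ⟨k, hk⟩ := Nat.eq_zero_or_eq_succ_pred (Nat.find hex) |>.imp_right
      fun h => (⟨_, h⟩ : ∃ k, Nat.find hex = k + 1)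
    · rw [hk, pow_zero, one_mul] at hspec
      exact le_add_right (ENNReal.ofReal_le_ofReal (Real.rpow_le_rpow (hf x) hspec hε.le))
    · rw [hk] at hspec
      have hpre : L ^ k * l < f x := not_le.1 (hmin k (by omega))
      refine le_add_left (le_trans ?_ (ENNReal.le_tsum k))
      rw [indicator_of_mem (show x ∈ {x | L ^ k * l < f x} from hpre), ← hpow]
      exact ENNReal.ofReal_le_ofReal (Real.rpow_le_rpow (hf x) hspec hε.le)
  calc ∫⁻ x, ENNReal.ofReal (f x ^ ε) ∂ν
      ≤ ∫⁻ x, (ENNReal.ofReal (l ^ ε) + ∑' k : ℕ, {x | L ^ k * l < f x}.indicator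
        (fun _ => Λ ^ (k + 1) * ENNReal.ofReal (l ^ ε)) x) ∂ν := lintegral_mono hpt
    _ = ENNReal.ofReal (l ^ ε) * ν univ +
        ∑' k : ℕ, Λ ^ (k + 1) * ENNReal.ofReal (l ^ ε) * ν {x | L ^ k * l < f x} := by
        rw [lintegral_add_left measurable_const, lintegral_const, lintegral_tsum
          fun k => (measurable_const.indicator (hset k)).aemeasurable]
        congr 2 with k
        rw [lintegral_indicator_const (hset k)]
    _ ≤ ENNReal.ofReal (l ^ ε) * ν univ +
        ∑' k : ℕ, (ENNReal.ofReal (l ^ ε) * Λ * ν univ) * (Λ * θ) ^ k := by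
        refine add_le_add le_rfl (ENNReal.tsum_le_tsum fun k => ?_)
        calc _ ≤ Λ ^ (k + 1) * ENNReal.ofReal (l ^ ε) * (θ ^ k * ν univ) := by
              gcongr; exact hdecay k
          _ = _ := by rw [mul_pow, pow_succ]; ring
    _ = _ := by rw [ENNReal.tsum_mul_left, ENNReal.tsum_geometric]; ring

lemma le_add_rpow_mul_rpow {q s t : ℝ} (hq : 1 < q) (hs : 0 < s) (ht : 0 ≤ t) :
    t ≤ s + s ^ (1 - q) * t ^ q := by
  rcases le_or_gt t s with h | h
  · exact h.trans (le_add_of_nonneg_right (by positivity))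
  · have ht0 := hs.trans h
    have h1 : t ^ (1 - q) ≤ s ^ (1 - q) :=
      Real.rpow_le_rpow_of_nonpos hs h.le (by linarith)
    have h2 : t ^ (1 - q) * t ^ q = t := by
      rw [← Real.rpow_add ht0, sub_add_cancel, Real.rpow_one]
    nlinarith [Real.rpow_nonneg ht q]

lemma setIntegral_le_of_stopping {n : ℕ} {f : En n → ℝ} {q C K l r : ℝ} (hq : 1 < q)
    (hfm : Measurable f) (hf0 : ∀ x, 0 ≤ f x)
    (hfi : Integrable f volume) (hfq : Integrable (fun x => f x ^ q) volume)
    (hC : 0 < C) (hK : 0 < K) (hKC : K ^ (1 - q) * (C * 8 ^ n) ≤ 1 / 4) (hl : 0 < l) (hr : 0 < r)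
    (x : En n)
    (h1 : ∫ y in ball x (8 * r), f y ^ q ≤ C * l ^ q * ballVol n (8 * r))
    (h2 : l * ballVol n r < ∫ y in ball x r, f y) :
    ∫ y in ball x (8 * r), f y ^ q ≤
      C * 8 ^ n * 4 * 2 ^ (q - 1) * ∫ y in ball x r ∩ {y | l / 2 < f y ∧ f y ≤ K * l}, f y ^ q := by
  set T := {y | l / 2 < f y ∧ f y ≤ K * l}
  have hT : MeasurableSet T :=
    (measurableSet_lt measurable_const hfm).inter (measurableSet_le hfm measurable_const)
  have hv := ballVol_pos n hr
  rw [ballVol_mul] at h1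
  have hpt : ∀ y, f y ≤ l / 2 + (l / 2) ^ (1 - q) * T.indicator (fun y => f y ^ q) y +
      (K * l) ^ (1 - q) * f y ^ q := by
    intro y
    have hy := hf0 y
    have hKl : 0 ≤ (K * l) ^ (1 - q) * f y ^ q := by positivity
    by_cases hyT : y ∈ T
    · rw [indicator_of_mem hyT]
      linarith [le_add_rpow_mul_rpow hq (half_pos hl) hy]
    · rw [indicator_of_notMem hyT, mul_zero, add_zero]
      by_cases h : l / 2 < f y
      · have h' : K * l < f y := not_le.1 fun h' => hyT ⟨h, h'⟩
        have hpos : 0 < K * l := by positivity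
        have h3 : f y ^ (1 - q) ≤ (K * l) ^ (1 - q) :=
          Real.rpow_le_rpow_of_nonpos hpos h'.le (by linarith)
        have h4 : f y ^ (1 - q) * f y ^ q = f y := by
          rw [← Real.rpow_add (hpos.trans h'), sub_add_cancel, Real.rpow_one]
        nlinarith [Real.rpow_nonneg hy q]
      · linarith
  have hball : volume.real (ball x r) = ballVol n r := volume_real_ball x hr
  have hconst : IntegrableOn (fun _ : En n => l / 2) (ball x r) volume :=
    integrableOn_const measure_ball_lt_top.ne
  have hind : IntegrableOn (fun y => (l / 2) ^ (1 - q) * T.indicator (fun y => f y ^ q) y)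
      (ball x r) volume := ((hfq.indicator hT).const_mul _).integrableOn
  have hpow : IntegrableOn (fun y => (K * l) ^ (1 - q) * f y ^ q) (ball x r) volume :=
    (hfq.const_mul _).integrableOn
  have hadd : IntegrableOn
      (fun y => l / 2 + (l / 2) ^ (1 - q) * T.indicator (fun y => f y ^ q) y) (ball x r) volume :=
    hconst.add hind
  have hfint : ∫ y in ball x r, f y ≤ l / 2 * ballVol n r +
      (l / 2) ^ (1 - q) * (∫ y in ball x r ∩ T, f y ^ q) +
      (K * l) ^ (1 - q) * ∫ y in ball x r, f y ^ q := by
    calc _ ≤ ∫ y in ball x r, (l / 2 + (l / 2) ^ (1 - q) * T.indicator (fun y => f y ^ q) y +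
          (K * l) ^ (1 - q) * f y ^ q) :=
          integral_mono hfi.integrableOn (hadd.add hpow) hpt
      _ = _ := by
          rw [integral_add hadd hpow, integral_add hconst hind, setIntegral_const,
            integral_const_mul, integral_const_mul, setIntegral_indicator hT, hball, smul_eq_mul,
            mul_comm (ballVol n r)]
  have hmono : ∫ y in ball x r, f y ^ q ≤ ∫ y in ball x (8 * r), f y ^ q :=
    setIntegral_mono_set hfq.integrableOn
      (Filter.Eventually.of_forall fun y => Real.rpow_nonneg (hf0 y) q)
      (ball_subset_ball (by linarith)).eventuallyLE
  set P := ∫ y in ball x r ∩ T, f y ^ q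
  set v := ballVol n r
  have hlq : l ^ (1 - q) * l ^ q = l := by
    rw [← Real.rpow_add hl, sub_add_cancel, Real.rpow_one]
  have hlast : (K * l) ^ (1 - q) * ∫ y in ball x r, f y ^ q ≤ 1 / 4 * l * v := by
    calc _ ≤ (K * l) ^ (1 - q) * (C * l ^ q * (8 ^ n * v)) := by
          gcongr; exact hmono.trans h1
      _ = (K ^ (1 - q) * (C * 8 ^ n)) * (l ^ (1 - q) * l ^ q) * v := by
          rw [Real.mul_rpow hK.le hl.le]; ring
      _ ≤ 1 / 4 * l * v := by rw [hlq]; gcongr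
  have hP : l * v ≤ 4 * ((l / 2) ^ (1 - q) * P) := by nlinarith
  have hhalf : l ^ (q - 1) * (l / 2) ^ (1 - q) = 2 ^ (q - 1) := by
    rw [Real.div_rpow hl.le (by norm_num), ← neg_sub q 1, Real.rpow_neg hl.le,
      Real.rpow_neg (by norm_num)]
    have : 0 < l ^ (q - 1) := by positivity
    field_simp
  have hlq' : l ^ q = l ^ (q - 1) * l := by
    nth_rw 3 [← Real.rpow_one l]
    rw [← Real.rpow_add hl, sub_add_cancel]
  calc _ ≤ C * l ^ q * (8 ^ n * v) := h1
    _ = C * 8 ^ n * l ^ (q - 1) * (l * v) := by rw [hlq']; ring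
    _ ≤ C * 8 ^ n * l ^ (q - 1) * (4 * ((l / 2) ^ (1 - q) * P)) := by gcongr
    _ = C * 8 ^ n * 4 * (l ^ (q - 1) * (l / 2) ^ (1 - q)) * P := by ring
    _ = _ := by rw [hhalf]

/-- Gehring's lemma for a function supported in a set `S`, assuming the reverse Hölder inequality
on balls centred in `S` of radius at most `R`. -/
lemma exists_lintegral_rpow_add_le (n : ℕ) {q C : ℝ} (hq : 1 < q) (hC : 0 < C) :
    ∃ ε : ℝ, 0 < ε ∧ ∃ M : ENNReal, M ≠ ⊤ ∧ ∀ (f : En n → ℝ) (S : Set (En n)) (R l : ℝ),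
      Measurable f → (∀ x, 0 ≤ f x) → Integrable f volume →
      Integrable (fun x => f x ^ q) volume → (∀ x ∉ S, f x = 0) → 0 < R → 0 < l →
      (∀ x ∈ S, ∀ r t, 0 < r → r ≤ R → 0 ≤ t → ∫ y in ball x r, f y ≤ t * ballVol n r →
        ∫ y in ball x r, f y ^ q ≤ C * t ^ q * ballVol n r) →
      (∀ x ∈ S, ∫ y in ball x R, f y ≤ l * ballVol n R) →
      ∫⁻ x, ENNReal.ofReal (f x ^ (q + ε)) ≤
        ENNReal.ofReal (l ^ ε) * M * ∫⁻ x, ENNReal.ofReal (f x ^ q) := by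
  set K : ℝ := max 1 ((C * 8 ^ n * 4) ^ (q - 1)⁻¹)
  have hK1 : 1 ≤ K := le_max_left _ _
  have hKC : K ^ (1 - q) * (C * 8 ^ n) ≤ 1 / 4 := by
    have h0 : 0 < C * 8 ^ n * 4 := by positivity
    have h1 : C * 8 ^ n * 4 ≤ K ^ (q - 1) := by
      have := Real.rpow_le_rpow (by positivity) (le_max_right 1 ((C * 8 ^ n * 4) ^ (q - 1)⁻¹))
        (sub_pos.2 hq).le
      rwa [Real.rpow_inv_rpow h0.le (sub_pos.2 hq).ne'] at this
    rw [← neg_sub q 1, Real.rpow_neg (by positivity), inv_mul_le_iff₀ (by positivity)]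
    linarith
  set D : ℝ := C * 8 ^ n * 4 * 2 ^ (q - 1)
  have hD : 0 < D := by positivity
  set L : ℝ := 2 * K
  have hL : 1 < L := by linarith
  set θ : ℝ := D / (1 + D)
  set ρ : ℝ := (1 + 2 * D) / (2 * D)
  have hρ : 1 < ρ := by rw [lt_div_iff₀ (by positivity)]; linarith
  have hρθ : ρ * θ < 1 := by
    rw [show ρ * θ = (1 + 2 * D) / (2 * (1 + D)) by simp only [ρ, θ]; field_simp,
      div_lt_one (by positivity)]
    linarith
  have hLρ : L ^ Real.logb L ρ = ρ :=
    Real.rpow_logb (one_pos.trans hL) hL.ne' (one_pos.trans hρ)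
  have hε : 0 < Real.logb L ρ := Real.logb_pos hL hρ
  set ε := Real.logb L ρ
  refine ⟨ε, hε, 1 + ENNReal.ofReal (L ^ ε) *
    (1 - ENNReal.ofReal (L ^ ε) * ENNReal.ofReal θ)⁻¹, ?_, ?_⟩
  · refine ENNReal.add_ne_top.2 ⟨ENNReal.one_ne_top, ENNReal.mul_ne_top ENNReal.ofReal_ne_top ?_⟩
    rw [ENNReal.inv_ne_top, hLρ, ← ENNReal.ofReal_mul (by positivity)]
    refine (tsub_pos_of_lt ?_).ne'
    rwa [ENNReal.ofReal_lt_one]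
  intro f S R l hfm hf0 hfi hfq hS hR hl hRH hlR
  have hqm : Measurable fun x => ENNReal.ofReal (f x ^ q) := (hfm.pow_const q).ennreal_ofReal
  set ν : Measure (En n) := volume.withDensity fun x => ENNReal.ofReal (f x ^ q)
  have hνs : ∀ s, MeasurableSet s → ν s = ENNReal.ofReal (∫ x in s, f x ^ q) := fun s hs => by
    rw [withDensity_apply _ hs, ofReal_integral_eq_lintegral_ofReal hfq.integrableOn
      (Filter.Eventually.of_forall fun x => Real.rpow_nonneg (hf0 x) q)]
  have hlevel : ∀ t, l ≤ t → ν {x | t < f x} ≤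
      ENNReal.ofReal D * ν {x | t / 2 < f x ∧ f x ≤ K * t} := by
    intro t hlt
    have ht := hl.trans_le hlt
    have hT : MeasurableSet {x | t / 2 < f x ∧ f x ≤ K * t} :=
      (measurableSet_lt measurable_const hfm).inter (measurableSet_le hfm measurable_const)
    refine measure_superlevel_le hfi.locallyIntegrable hS hR ht (fun x hx => (hlR x hx).trans ?_)
      (withDensity_absolutelyContinuous _ _) hT fun x hx r hr hrR h1 h2 => ?_
    · exact mul_le_mul_of_nonneg_right hlt (ballVol_pos n hR).le
    · rw [hνs _ measurableSet_ball, hνs _ (measurableSet_ball.inter hT),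
        ← ENNReal.ofReal_mul hD.le]
      exact ENNReal.ofReal_le_ofReal (setIntegral_le_of_stopping hq hfm hf0 hfi hfq hC
        (by positivity) hKC ht hr x (hRH x hx _ _ (by positivity) hrR ht.le h1) h2)
  have hdecay : ∀ t, l ≤ t → ν {x | L * t < f x} ≤ ENNReal.ofReal θ * ν {x | t < f x} := by
    intro t hlt
    have ht := hl.trans_le hlt
    have h1 := hlevel (2 * t) (by linarith)
    rw [mul_div_cancel_left₀ t two_ne_zero, show K * (2 * t) = L * t by simp only [L]; ring] at h1
    have hLt : 2 * t ≤ L * t := by simp only [L]; nlinarith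
    have h2 : ν {x | L * t < f x} ≤ ν {x | 2 * t < f x} :=
      measure_mono fun x hx => hLt.trans_lt hx
    have h3 : ν {x | t < f x} =
        ν {x | t < f x ∧ f x ≤ L * t} + ν {x | L * t < f x} := by
      rw [← measure_union _ (measurableSet_lt measurable_const hfm)]
      · congr 1
        ext x
        simp only [mem_ofPred_eq, mem_union]
        constructor
        · intro h
          exact (le_or_gt (f x) (L * t)).imp (fun h' => ⟨h, h'⟩) id
        · rintro (h | h)
          · exact h.1
          · linarith
      · exact disjoint_left.2 fun x hx hx' => not_lt.2 hx.2 hx'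
    rw [h3]
    have h4 : (1 + ENNReal.ofReal D) * ν {x | L * t < f x} ≤ ENNReal.ofReal D *
        (ν {x | t < f x ∧ f x ≤ L * t} + ν {x | L * t < f x}) := by
      rw [add_mul, one_mul, mul_add]
      gcongr
      exact h2.trans h1
    rw [ENNReal.ofReal_div_of_pos (by positivity), ENNReal.ofReal_add one_pos.le hD.le,
      ENNReal.ofReal_one, ENNReal.mul_comm_div, ← mul_div_assoc, ENNReal.le_div_iff_mul_le
      (by simp) (by simp), mul_comm]
    exact h4
  have hmain := lintegral_rpow_le_of_decay hfm hf0 hl hL hε hdecay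
  rw [lintegral_withDensity_eq_lintegral_mul _ hqm (hfm.pow_const ε).ennreal_ofReal,
    withDensity_apply _ MeasurableSet.univ, setLIntegral_univ] at hmain
  refine (lintegral_congr fun x => ?_).trans_le hmain
  rw [Pi.mul_apply, ← ENNReal.ofReal_mul (Real.rpow_nonneg (hf0 x) q),
    Real.rpow_add_of_nonneg (hf0 x) (by linarith) hε.le]

namespace ReverseHolderWith

variable {n : ℕ} {q A : ℝ} {V W : En n → ℝ}

lemma congr_ae (hV : ReverseHolderWith n q V A) (hW : ∀ x, 0 ≤ W x) (h : V =ᵐ[volume] W) :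
    ReverseHolderWith n q W A := by
  have hq : (fun y => V y ^ q) =ᵐ[volume] fun y => W y ^ q := h.mono fun x hx => by simp only [hx]
  refine ⟨hW, hV.2.1.congr h, hV.2.2.1.congr hq, fun x r hr => ?_⟩
  rw [← setIntegral_congr_ae measurableSet_ball (h.mono fun y hy _ => hy),
    ← setIntegral_congr_ae measurableSet_ball (hq.mono fun y hy _ => hy)]
  exact hV.2.2.2 x r hr

lemma integrableOn_ball_s16 (hV : ReverseHolderWith n q V A) (x : En n) (r : ℝ) :
    IntegrableOn V (ball x r) volume :=
  (hV.2.1.integrableOn_isCompact (isCompact_closedBall x r)).mono_set ball_subset_closedBall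

lemma integrableOn_rpow_ball (hV : ReverseHolderWith n q V A) (x : En n) (r : ℝ) :
    IntegrableOn (fun y => V y ^ q) (ball x r) volume :=
  (hV.2.2.1.integrableOn_isCompact (isCompact_closedBall x r)).mono_set ball_subset_closedBall

lemma setIntegral_mono (hV : ReverseHolderWith n q V A) (x : En n) (r : ℝ) {s : Set (En n)}
    (hs : s ⊆ ball x r) : ∫ y in s, V y ≤ ∫ y in ball x r, V y :=
  setIntegral_mono_set (hV.integrableOn_ball_s16 x r) (Filter.Eventually.of_forall hV.1)
    hs.eventuallyLE

lemma setIntegral_rpow_mono (hV : ReverseHolderWith n q V A) (x : En n) (r : ℝ) {s : Set (En n)}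
    (hs : s ⊆ ball x r) : ∫ y in s, V y ^ q ≤ ∫ y in ball x r, V y ^ q :=
  setIntegral_mono_set (hV.integrableOn_rpow_ball x r)
    (Filter.Eventually.of_forall fun y => Real.rpow_nonneg (hV.1 y) q) hs.eventuallyLE

lemma setIntegral_rpow_le (hV : ReverseHolderWith n q V A) (hq : 0 < q) (hA : 0 ≤ A) (x : En n)
    {r t : ℝ} (hr : 0 < r) (ht : 0 ≤ t) (h : ∫ y in ball x r, V y ≤ t * ballVol n r) :
    ∫ y in ball x r, V y ^ q ≤ A ^ q * t ^ q * ballVol n r := by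
  have hv := ballVol_pos n hr
  have h1 := hV.2.2.2 x r hr
  rw [← measureReal_def, volume_real_ball x hr] at h1
  have h2 : (ballVol n r)⁻¹ * ∫ y in ball x r, V y ≤ t := by
    rwa [inv_mul_le_iff₀ hv, mul_comm]
  have h3 := (Real.rpow_inv_le_iff_of_pos (mul_nonneg (inv_nonneg.2 hv.le)
    (integral_nonneg fun y => Real.rpow_nonneg (hV.1 y) q)) (mul_nonneg hA ht) hq).1
    (h1.trans (mul_le_mul_of_nonneg_left h2 hA))
  rw [Real.mul_rpow hA ht, inv_mul_le_iff₀ hv] at h3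
  linarith

end ReverseHolderWith

lemma exists_setIntegral_ball_le_two_mul (n : ℕ) {q A : ℝ} (hq : 1 < q) (hA : 0 < A) :
    ∃ δ : ℝ, 0 < δ ∧ δ < 1 ∧ ∀ V : En n → ℝ, ReverseHolderWith n q V A → ∀ (x : En n) (r : ℝ),
      0 < r → ∫ y in ball x r, V y ≤ 2 * ∫ y in ball x (δ * r), V y := by
  have hA4 : 0 < 4 * A ^ q := by positivity
  set M : ℝ := (4 * A ^ q) ^ (q - 1)⁻¹
  have hM : 0 < M := by positivity
  have hMA : M ^ (1 - q) * A ^ q = 1 / 4 := by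
    rw [← neg_sub q 1, Real.rpow_neg hM.le, Real.rpow_inv_rpow hA4.le (sub_pos.2 hq).ne']
    field_simp
  obtain ⟨δ, hδM, hδ0, hδ1⟩ : ∃ δ : ℝ, M * (1 - δ ^ n) < 1 / 4 ∧ 0 < δ ∧ δ < 1 := by
    have hc : Filter.Tendsto (fun δ : ℝ => M * (1 - δ ^ n)) (nhdsWithin 1 (Iio 1)) (nhds 0) := by
      have : Continuous fun δ : ℝ => M * (1 - δ ^ n) := by fun_prop
      simpa using (this.tendsto 1).mono_left nhdsWithin_le_nhds
    exact ((hc.eventually (gt_mem_nhds (by norm_num))).and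
      (Ioo_mem_nhdsLT (zero_lt_one' ℝ))).exists
  refine ⟨δ, hδ0, hδ1, fun V hV x r hr => ?_⟩
  have hv := ballVol_pos n hr
  have hsub : ball x (δ * r) ⊆ ball x r := ball_subset_ball (by nlinarith)
  set I := ∫ y in ball x r, V y
  have hI0 : 0 ≤ I := integral_nonneg hV.1
  have hJ0 : 0 ≤ ∫ y in ball x (δ * r), V y := integral_nonneg hV.1
  obtain hI | hI := hI0.eq_or_lt
  · rw [← hI]
    linarith
  set a := I / ballVol n r
  have ha : 0 < a := div_pos hI hv
  have hIa : I = a * ballVol n r := (div_mul_cancel₀ I hv.ne').symm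
  have hpow := hV.setIntegral_rpow_le (one_pos.trans hq) hA.le x hr ha.le hIa.le
  set E := ball x r \ ball x (δ * r)
  have hE : E ⊆ ball x r := sdiff_subset
  have hEvol : volume.real E = (1 - δ ^ n) * ballVol n r := by
    rw [measureReal_sdiff hsub measurableSet_ball measure_ball_lt_top.ne, volume_real_ball x hr,
      volume_real_ball x (by positivity), ballVol_mul]
    ring
  have hEI : ∫ y in E, V y = I - ∫ y in ball x (δ * r), V y :=
    setIntegral_sdiff measurableSet_ball (hV.integrableOn_ball_s16 x r) hsub
  have hEfin : volume E ≠ ⊤ := measure_ne_top_of_subset hE measure_ball_lt_top.ne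
  have hc : IntegrableOn (fun _ : En n => M * a) E volume := integrableOn_const hEfin
  have hqi : IntegrableOn (fun y => (M * a) ^ (1 - q) * V y ^ q) E volume :=
    ((hV.integrableOn_rpow_ball x r).mono_set hE).const_mul _
  have hEle : ∫ y in E, V y ≤ M * a * ((1 - δ ^ n) * ballVol n r) +
      (M * a) ^ (1 - q) * ∫ y in E, V y ^ q := by
    calc _ ≤ ∫ y in E, (M * a + (M * a) ^ (1 - q) * V y ^ q) :=
          integral_mono ((hV.integrableOn_ball_s16 x r).mono_set hE) (hc.add hqi)
            fun y => le_add_rpow_mul_rpow hq (by positivity) (hV.1 y)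
      _ = _ := by
          rw [integral_add hc hqi, setIntegral_const, integral_const_mul, hEvol, smul_eq_mul,
            mul_comm (M * a)]
  have haq : a ^ (1 - q) * a ^ q = a := by
    rw [← Real.rpow_add ha, sub_add_cancel, Real.rpow_one]
  have hlast : (M * a) ^ (1 - q) * ∫ y in E, V y ^ q ≤ 1 / 4 * I := by
    calc _ ≤ (M * a) ^ (1 - q) * (A ^ q * a ^ q * ballVol n r) := by
          gcongr
          exact (hV.setIntegral_rpow_mono x r hE).trans hpow
      _ = (M ^ (1 - q) * A ^ q) * (a ^ (1 - q) * a ^ q) * ballVol n r := by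
          rw [Real.mul_rpow hM.le ha.le]
          ring
      _ = 1 / 4 * I := by rw [hMA, haq, hIa, mul_assoc]
  have hfirst : M * a * ((1 - δ ^ n) * ballVol n r) ≤ 1 / 4 * I := by
    calc _ = M * (1 - δ ^ n) * I := by rw [hIa]; ring
      _ ≤ 1 / 4 * I := by gcongr
  linarith

lemma exists_setIntegral_ball_le_mul (n : ℕ) {q A : ℝ} (hq : 1 < q) (hA : 0 < A) :
    ∃ D : ℝ, 0 < D ∧ ∀ V : En n → ℝ, ReverseHolderWith n q V A → ∀ (x : En n) (r : ℝ),
      0 < r → ∫ y in ball x (8 * r), V y ≤ D * ∫ y in ball x r, V y := by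
  obtain ⟨δ, hδ0, hδ1, h⟩ := exists_setIntegral_ball_le_two_mul n hq hA
  obtain ⟨k, hk⟩ := exists_pow_lt_of_lt_one (show (0 : ℝ) < 1 / 8 by norm_num) hδ1
  refine ⟨2 ^ k, by positivity, fun V hV x r hr => ?_⟩
  have hiter : ∀ m : ℕ, ∀ s, 0 < s →
      ∫ y in ball x s, V y ≤ 2 ^ m * ∫ y in ball x (δ ^ m * s), V y := by
    intro m
    induction m with
    | zero => simp
    | succ m ih =>
      intro s hs
      have h1 := h V hV x (δ ^ m * s) (by positivity)
      rw [← mul_assoc, ← pow_succ'] at h1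
      calc _ ≤ 2 ^ m * ∫ y in ball x (δ ^ m * s), V y := ih s hs
        _ ≤ 2 ^ m * (2 * ∫ y in ball x (δ ^ (m + 1) * s), V y) := by gcongr
        _ = _ := by rw [← mul_assoc, ← pow_succ]
  exact (hiter k (8 * r) (by positivity)).trans (mul_le_mul_of_nonneg_left
    (hV.setIntegral_mono x r (ball_subset_ball (by nlinarith))) (by positivity))

lemma exists_ball_subset_inter_ball {n : ℕ} {x x₀ : En n} {r R : ℝ} (hx : x ∈ ball x₀ R)
    (hr : 0 < r) (hrR : r ≤ 2 * R) :
    ∃ y, ball y (r / 4) ⊆ ball x r ∩ ball x₀ R ∧ ball x r ⊆ ball y (2 * r) := by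
  have hR : 0 < R := by linarith
  rw [mem_ball] at hx
  set t := r / (4 * R)
  have ht0 : 0 < t := by positivity
  have htR : t * R = r / 4 := by simp only [t]; field_simp
  have ht1 : t ≤ 1 := by
    rw [div_le_one (by positivity)]
    linarith
  have h1 : dist (AffineMap.lineMap x x₀ t : En n) x ≤ r / 4 := by
    rw [dist_lineMap_left, Real.norm_of_nonneg ht0.le, ← htR]
    gcongr
  have h2 : dist (AffineMap.lineMap x x₀ t : En n) x₀ ≤ R - r / 4 := by
    rw [dist_lineMap_right, Real.norm_of_nonneg (by linarith), ← htR]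
    nlinarith
  refine ⟨AffineMap.lineMap x x₀ t, subset_inter (ball_subset_ball' (by linarith))
    (ball_subset_ball' (by linarith)), ball_subset_ball' ?_⟩
  rw [dist_comm]
  linarith

/-- The higher integrability estimate for measurable reverse Hölder weights. -/
lemma exists_lintegral_ball_rpow_add_le (n : ℕ) {q A : ℝ} (hq : 1 < q) (hA : 0 < A) :
    ∃ ε : ℝ, 0 < ε ∧ ∃ M : ENNReal, M ≠ ⊤ ∧ ∀ V : En n → ℝ, Measurable V →
      ReverseHolderWith n q V A → ∀ (x : En n) (r l : ℝ), 0 < r → 0 < l →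
      ∫ y in ball x r, V y ≤ l * ballVol n r →
      ∫⁻ y in ball x r, ENNReal.ofReal (V y ^ (q + ε)) ≤
        ENNReal.ofReal (l ^ ε) * M * ENNReal.ofReal (∫ y in ball x r, V y ^ q) := by
  have hq0 : 0 < q := one_pos.trans hq
  obtain ⟨D, hD, hdoub⟩ := exists_setIntegral_ball_le_mul n hq hA
  obtain ⟨ε, hε, M, hM, hcore⟩ :=
    exists_lintegral_rpow_add_le n hq (C := A ^ q * D ^ q * 2 ^ n) (by positivity)
  refine ⟨ε, hε, M, hM, fun V hVm hV x₀ R l hR hl hlR => ?_⟩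
  set S := ball x₀ R
  have hSm : MeasurableSet S := measurableSet_ball
  have hpow : ∀ p : ℝ, 0 < p → ∀ x, S.indicator V x ^ p = S.indicator (fun y => V y ^ p) x := by
    intro p hp x
    by_cases hx : x ∈ S
    · simp only [indicator_of_mem hx]
    · simp only [indicator_of_notMem hx, Real.zero_rpow hp.ne']
  have hvol : ∀ r, 0 < r → ballVol n r ≤ ballVol n (2 * r) := fun r hr => by
    rw [ballVol_mul]
    exact le_mul_of_one_le_left (ballVol_pos n hr).le (one_le_pow₀ (by norm_num))
  have hlp : ∀ p : ℝ, 0 < p → ∫⁻ x, ENNReal.ofReal (S.indicator V x ^ p) =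
      ∫⁻ x in S, ENNReal.ofReal (V x ^ p) := fun p hp => by
    rw [← lintegral_indicator hSm]
    refine lintegral_congr fun x => ?_
    rw [hpow p hp]
    by_cases hx : x ∈ S
    · simp only [indicator_of_mem hx]
    · simp only [indicator_of_notMem hx, ENNReal.ofReal_zero]
  have hmain := hcore (S.indicator V) S (2 * R) l (hVm.indicator hSm)
    (indicator_nonneg fun x _ => hV.1 x)
    ((integrable_indicator_iff hSm).2 (hV.integrableOn_ball_s16 x₀ R))
    (by
      simp only [hpow q hq0]
      exact (integrable_indicator_iff hSm).2 (hV.integrableOn_rpow_ball x₀ R))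
    (fun x hx => indicator_of_notMem hx V) (by positivity) hl ?_ ?_
  · rwa [hlp _ hq0, hlp _ (by positivity), ← ofReal_integral_eq_lintegral_ofReal
      (hV.integrableOn_rpow_ball x₀ R)
      (Filter.Eventually.of_forall fun x => Real.rpow_nonneg (hV.1 x) q)] at hmain
  · intro x hx r t hr hrR ht h
    obtain ⟨y, hy1, hy2⟩ := exists_ball_subset_inter_ball hx hr hrR
    simp only [hpow q hq0]
    rw [setIntegral_indicator hSm] at h ⊢
    have h1 : ∫ z in ball y (2 * r), V z ≤ (D * t) * ballVol n (2 * r) := by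
      have := hdoub V hV y (r / 4) (by positivity)
      rw [show 8 * (r / 4) = 2 * r by ring] at this
      calc _ ≤ D * ∫ z in ball y (r / 4), V z := this
        _ ≤ D * ∫ z in ball x r ∩ S, V z := by
            refine mul_le_mul_of_nonneg_left ?_ hD.le
            exact setIntegral_mono_set ((hV.integrableOn_ball_s16 x r).mono_set inter_subset_left)
              (Filter.Eventually.of_forall hV.1) hy1.eventuallyLE
        _ ≤ D * (t * ballVol n (2 * r)) := by
            gcongr
            exact h.trans (mul_le_mul_of_nonneg_left (hvol r hr) ht)
        _ = _ := (mul_assoc _ _ _).symm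
    calc _ ≤ ∫ z in ball y (2 * r), V z ^ q :=
          hV.setIntegral_rpow_mono _ _ (inter_subset_left.trans hy2)
      _ ≤ A ^ q * (D * t) ^ q * ballVol n (2 * r) :=
          hV.setIntegral_rpow_le hq0 hA.le y (by positivity) (by positivity) h1
      _ = _ := by rw [Real.mul_rpow hD.le ht, ballVol_mul]; ring
  · intro x hx
    rw [setIntegral_indicator hSm]
    calc _ ≤ ∫ z in S, V z := hV.setIntegral_mono x₀ R inter_subset_right
      _ ≤ l * ballVol n R := hlR
      _ ≤ _ := mul_le_mul_of_nonneg_left (hvol R hR) hl.le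

/-- Gehring's self-improvement: `V ∈ B_q` implies `V ∈ B_{q+ε}` for some `ε > 0`
depending only on `n`, `q` and the reverse Hölder constant, with controlled constant. -/
theorem statement16 (n : ℕ) (hn : 1 ≤ n) (q : ℝ) (hq : 1 < q) (A : ℝ) (hA : 0 < A) :
    ∃ ε : ℝ, 0 < ε ∧ ∃ A' : ℝ, 0 < A' ∧
      ∀ V : En n → ℝ, ReverseHolderWith n q V A →
        ReverseHolderWith n (q + ε) V A' := by
  have hq0 : 0 < q := one_pos.trans hq
  obtain ⟨ε, hε, M, hM, hmain⟩ := exists_lintegral_ball_rpow_add_le n hq hA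
  have hp : 0 < q + ε := by positivity
  set B : ℝ := (M.toReal + 1) * A ^ q
  have hB : 0 < B := by positivity
  refine ⟨ε, hε, B ^ (q + ε)⁻¹, by positivity, ?_⟩
  suffices key : ∀ V : En n → ℝ, Measurable V → ReverseHolderWith n q V A →
      ReverseHolderWith n (q + ε) V (B ^ (q + ε)⁻¹) by
    intro V hV
    have hVae := hV.2.1.aestronglyMeasurable.aemeasurable
    have hW : V =ᵐ[volume] fun x => max (hVae.mk V x) 0 := by
      filter_upwards [hVae.ae_eq_mk] with x hx
      rw [← hx, max_eq_left (hV.1 x)]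
    exact (key _ (hVae.measurable_mk.max measurable_const)
      (hV.congr_ae (fun x => le_max_right _ _) hW)).congr_ae hV.1 hW.symm
  intro V hVm hV
  have hm : Measurable fun y => V y ^ (q + ε) := hVm.pow_const _
  have hnn : ∀ y, 0 ≤ V y ^ (q + ε) := fun y => Real.rpow_nonneg (hV.1 y) _
  have hfint : ∀ (x : En n) (r : ℝ), 0 < r →
      IntegrableOn (fun y => V y ^ (q + ε)) (ball x r) volume := by
    intro x r hr
    have hv := ballVol_pos n hr
    have h0 : 0 ≤ ∫ y in ball x r, V y := integral_nonneg hV.1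
    refine ⟨hm.aestronglyMeasurable, ?_⟩
    rw [hasFiniteIntegral_iff_ofReal (Filter.Eventually.of_forall hnn)]
    refine (hmain V hVm hV x r ((∫ y in ball x r, V y) / ballVol n r + 1) hr (by positivity)
      ?_).trans_lt ?_
    · rw [add_mul, div_mul_cancel₀ _ hv.ne']
      linarith
    · exact ENNReal.mul_lt_top (ENNReal.mul_lt_top ENNReal.ofReal_lt_top hM.lt_top)
        ENNReal.ofReal_lt_top
  refine ⟨hV.1, hV.2.1, fun x => ⟨ball x 1, ball_mem_nhds x one_pos,
    hfint x 1 one_pos⟩, fun x r hr => ?_⟩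
  rw [← measureReal_def, volume_real_ball x hr]
  have hv := ballVol_pos n hr
  set I := ∫ y in ball x r, V y
  have hI : 0 ≤ I := integral_nonneg hV.1
  set a := (ballVol n r)⁻¹ * I
  have ha : 0 ≤ a := by positivity
  have hIa : I = a * ballVol n r := by
    simp only [a]
    field_simp
  have hVq := hV.setIntegral_rpow_le hq0 hA.le x hr ha hIa.le
  have hreal : ∀ l, 0 < l → a ≤ l →
      ∫ y in ball x r, V y ^ (q + ε) ≤ l ^ ε * B * a ^ q * ballVol n r := by
    intro l hl hal
    have h := hmain V hVm hV x r l hr hl (hIa.le.trans (mul_le_mul_of_nonneg_right hal hv.le))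
    rw [← ofReal_integral_eq_lintegral_ofReal (hfint x r hr) (Filter.Eventually.of_forall hnn),
      ← ENNReal.ofReal_toReal hM, ← ENNReal.ofReal_mul (by positivity),
      ← ENNReal.ofReal_mul (by positivity), ENNReal.ofReal_le_ofReal_iff (mul_nonneg
      (by positivity) (integral_nonneg fun y => Real.rpow_nonneg (hV.1 y) q))] at h
    calc _ ≤ l ^ ε * M.toReal * ∫ y in ball x r, V y ^ q := h
      _ ≤ l ^ ε * (M.toReal + 1) * (A ^ q * a ^ q * ballVol n r) := by
          gcongr
          · exact integral_nonneg fun y => Real.rpow_nonneg (hV.1 y) q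
          · linarith
      _ = _ := by simp only [B]; ring
  have hfinal : ∫ y in ball x r, V y ^ (q + ε) ≤ B * a ^ (q + ε) * ballVol n r := by
    obtain h0 | hpos := ha.eq_or_lt
    · have h1 := hreal 1 one_pos (by linarith)
      rw [← h0, Real.zero_rpow hq0.ne', mul_zero, zero_mul] at h1
      rwa [← h0, Real.zero_rpow hp.ne', mul_zero, zero_mul]
    · refine (hreal a hpos le_rfl).trans_eq ?_
      rw [Real.rpow_add hpos]
      ring
  rw [Real.rpow_inv_le_iff_of_pos (mul_nonneg (inv_nonneg.2 hv.le) (integral_nonneg hnn))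
    (by positivity) hp, Real.mul_rpow (by positivity) ha, Real.rpow_inv_rpow hB.le hp.ne',
    inv_mul_le_iff₀ hv]
  linarith
end
end

section
/- Let n ≥ 1 and let V : ℝⁿ → ℝ be a polynomial function with V(x) ≥ 0 for all x. Then there is a constant C > 0, depending only on n and the degree of V, such that max_{x ∈ B} V(x) ≤ C |B|⁻¹ ∫_B V(y) dy for every ball B ⊂ ℝⁿ. Consequently V belongs to the reverse Hölder class B_q for every q ∈ (1, ∞), with a constant uniform in q. -/
open MeasureTheory Metric Set
open RealInnerProductSpace

noncomputable section

theorem exists_norm_le_mul_norm_of_ker_le {F X Y : Type*} [AddCommGroup F] [Module ℝ F]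
    [FiniteDimensional ℝ F] [NormedAddCommGroup X] [NormedSpace ℝ X] [NormedAddCommGroup Y]
    [NormedSpace ℝ Y] (T : F →ₗ[ℝ] X) (S : F →ₗ[ℝ] Y) (h : LinearMap.ker T ≤ LinearMap.ker S) :
    ∃ C : ℝ, 0 < C ∧ ∀ p, ‖S p‖ ≤ C * ‖T p‖ := by
  let g : LinearMap.range T →L[ℝ] Y := LinearMap.toContinuousLinearMap
    (((LinearMap.ker T).liftQ S h).comp T.quotKerEquivRange.symm.toLinearMap)
  have hg (p : F) : g ⟨T p, LinearMap.mem_range_self T p⟩ = S p := by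
    have hq : T.quotKerEquivRange.symm ⟨T p, LinearMap.mem_range_self T p⟩
        = (LinearMap.ker T).mkQ p := T.quotKerEquivRange_symm_apply_image p _
    simp [g, hq]
  refine ⟨‖g‖ + 1, by positivity, fun p => ?_⟩
  calc ‖S p‖ = ‖g ⟨T p, LinearMap.mem_range_self T p⟩‖ := by rw [hg]
    _ ≤ ‖g‖ * ‖T p‖ := g.le_opNorm _
    _ ≤ (‖g‖ + 1) * ‖T p‖ := by gcongr; linarith

theorem continuous_eval_coords {n : ℕ} (p : MvPolynomial (Fin n) ℝ) :
    Continuous fun x : En n => MvPolynomial.eval (fun i => x i) p :=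
  p.continuous_eval.comp (PiLp.continuous_ofLp 2 _)

theorem integrable_eval_coords_unitBall {n : ℕ} (p : MvPolynomial (Fin n) ℝ) :
    Integrable (fun x : En n => MvPolynomial.eval (fun i => x i) p)
      (volume.restrict (ball 0 1)) :=
  ((continuous_eval_coords p).locallyIntegrable.integrableOn_isCompact
    (isCompact_closedBall 0 1)).mono_set ball_subset_closedBall

/-- The class in `L¹` of the unit ball of a polynomial function. -/
def evalL1UnitBall (n : ℕ) :
    MvPolynomial (Fin n) ℝ →ₗ[ℝ] (En n →₁[volume.restrict (ball (0 : En n) 1)] ℝ) where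
  toFun p := (integrable_eval_coords_unitBall p).toL1 _
  map_add' p q := by
    rw [← Integrable.toL1_add, Integrable.toL1_eq_toL1_iff]
    exact .of_forall fun x => by simp
  map_smul' c p := by
    rw [RingHom.id_apply, ← Integrable.toL1_smul, Integrable.toL1_eq_toL1_iff]
    exact .of_forall fun x => by simp [MvPolynomial.smul_eval]

/-- The restriction of a polynomial function to the closed unit ball. -/
def evalClosedUnitBall (n : ℕ) :
    MvPolynomial (Fin n) ℝ →ₗ[ℝ] C(closedBall (0 : En n) 1, ℝ) where
  toFun p := ⟨fun x => MvPolynomial.eval (fun i => x.1 i) p,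
    (continuous_eval_coords p).comp continuous_subtype_val⟩
  map_add' p q := by ext x; simp
  map_smul' c p := by ext x; simp [MvPolynomial.smul_eval]

theorem ker_evalL1UnitBall_le (n : ℕ) :
    LinearMap.ker (evalL1UnitBall n) ≤ LinearMap.ker (evalClosedUnitBall n) := by
  intro p hp
  have h0 : (fun x : En n => MvPolynomial.eval (fun i => x i) p)
      =ᵐ[volume.restrict (ball 0 1)] fun _ => 0 := by
    have hp' : (integrable_eval_coords_unitBall p).toL1 _ = 0 := hp
    exact Integrable.coeFn_toL1 (integrable_eval_coords_unitBall p) |>.symm.trans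
      (hp' ▸ Lp.coeFn_zero _ _ _)
  have hball := Measure.eqOn_open_of_ae_eq h0 isOpen_ball
    (continuous_eval_coords p).continuousOn continuousOn_const
  have hcl := hball.closure (continuous_eval_coords p) continuous_const
  rw [closure_ball _ one_ne_zero] at hcl
  rw [LinearMap.mem_ker]
  ext x
  exact hcl x.2

theorem exists_eval_le_mul_integral_unitBall (n d : ℕ) :
    ∃ C : ℝ, 0 < C ∧ ∀ p : MvPolynomial (Fin n) ℝ, p.totalDegree ≤ d →
      ∀ z ∈ closedBall (0 : En n) 1, |MvPolynomial.eval (fun i => z i) p|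
        ≤ C * ∫ y in ball (0 : En n) 1, |MvPolynomial.eval (fun i => y i) p| := by
  have : CompactSpace (closedBall (0 : En n) 1) :=
    isCompact_iff_compactSpace.mp (isCompact_closedBall 0 1)
  let P := MvPolynomial.restrictTotalDegree (Fin n) ℝ d
  obtain ⟨C, hC, h⟩ := exists_norm_le_mul_norm_of_ker_le ((evalL1UnitBall n).domRestrict P)
    ((evalClosedUnitBall n).domRestrict P) fun p hp => ker_evalL1UnitBall_le n hp
  refine ⟨C, hC, fun p hp z hz => ?_⟩
  have hbound := h ⟨p, (MvPolynomial.mem_restrictTotalDegree _ _ _).2 hp⟩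
  rw [LinearMap.domRestrict_apply, LinearMap.domRestrict_apply] at hbound
  calc |MvPolynomial.eval (fun i => z i) p|
      ≤ ‖evalClosedUnitBall n p‖ := (evalClosedUnitBall n p).norm_coe_le_norm ⟨z, hz⟩
    _ ≤ C * ‖evalL1UnitBall n p‖ := hbound
    _ = _ := by
      congr 1
      exact L1.norm_of_fun_eq_integral_norm (hf := integrable_eval_coords_unitBall p)

theorem totalDegree_aeval_le {σ τ R : Type*} [CommSemiring R] (p : MvPolynomial σ R)
    (f : σ → MvPolynomial τ R) (hf : ∀ i, (f i).totalDegree ≤ 1) :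
    (MvPolynomial.aeval f p).totalDegree ≤ p.totalDegree := by
  rw [MvPolynomial.aeval_def, MvPolynomial.eval₂_eq]
  refine MvPolynomial.totalDegree_finsetSum_le fun m hm => ?_
  rw [MvPolynomial.algebraMap_eq]
  refine (MvPolynomial.totalDegree_mul _ _).trans ?_
  rw [MvPolynomial.totalDegree_C, zero_add]
  refine (MvPolynomial.totalDegree_finsetProd _ _).trans ?_
  refine (Finset.sum_le_sum fun i _ => ?_).trans (MvPolynomial.le_totalDegree hm)
  calc (f i ^ m i).totalDegree ≤ m i * (f i).totalDegree := MvPolynomial.totalDegree_pow _ _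
    _ ≤ m i * 1 := by gcongr; exact hf i
    _ = m i := mul_one _

theorem average_ball_eq_average_unitBall {n : ℕ} (f : En n → ℝ) (x : En n) {r : ℝ} (hr : 0 < r) :
    (volume (ball x r)).toReal⁻¹ * ∫ y in ball x r, f y
      = (volume (ball (0 : En n) 1)).toReal⁻¹ * ∫ y in ball (0 : En n) 1, f (x + r • y) := by
  have htrans : ∫ y in ball x r, f y = ∫ y in ball (0 : En n) r, f (x + y) := by
    rw [← (measurePreserving_add_left volume x).setIntegral_preimage_emb
      (measurableEmbedding_addLeft x)]
    simp
  rw [Measure.setIntegral_comp_smul_of_pos volume (fun y => f (x + y)) _ hr,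
    smul_unitBall_of_pos hr, htrans, Measure.addHaar_ball_of_pos volume x hr, ENNReal.toReal_mul,
    ENNReal.toReal_ofReal (by positivity), smul_eq_mul, mul_inv]
  ring

theorem exists_eval_le_mul_average (n d : ℕ) :
    ∃ C : ℝ, 0 < C ∧ ∀ p : MvPolynomial (Fin n) ℝ, p.totalDegree ≤ d →
      (∀ x : En n, 0 ≤ MvPolynomial.eval (fun i => x i) p) →
      ∀ (x : En n) (r : ℝ), 0 < r → ∀ z ∈ ball x r,
        MvPolynomial.eval (fun i => z i) p ≤ C * ((volume (ball x r)).toReal⁻¹ *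
          ∫ y in ball x r, MvPolynomial.eval (fun i => y i) p) := by
  obtain ⟨C, hC, h⟩ := exists_eval_le_mul_integral_unitBall n d
  have hvol : 0 < (volume (ball (0 : En n) 1)).toReal :=
    ENNReal.toReal_pos (measure_ball_pos _ _ one_pos).ne' measure_ball_lt_top.ne
  refine ⟨C * (volume (ball (0 : En n) 1)).toReal, by positivity, fun p hp hp0 x r hr z hz => ?_⟩
  let f (i : Fin n) : MvPolynomial (Fin n) ℝ :=
    MvPolynomial.C (x i) + MvPolynomial.C r * MvPolynomial.X i
  have hf (i : Fin n) : (f i).totalDegree ≤ 1 := by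
    refine (MvPolynomial.totalDegree_add _ _).trans (max_le (by simp) ?_)
    exact (MvPolynomial.totalDegree_mul _ _).trans (by simp)
  have heval (y : En n) : MvPolynomial.eval (fun i => y i) (MvPolynomial.aeval f p)
      = MvPolynomial.eval (fun i => (x + r • y) i) p := by
    rw [MvPolynomial.aeval_eq_bind₁, MvPolynomial.eval, MvPolynomial.eval₂Hom_bind₁]
    simp [f]
  have hz' : r⁻¹ • (z - x) ∈ closedBall (0 : En n) 1 := by
    rw [mem_ball, dist_eq_norm] at hz
    rw [mem_closedBall_zero_iff, norm_smul, norm_inv, Real.norm_of_nonneg hr.le,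
      inv_mul_le_one₀ hr]
    exact hz.le
  have hbound := h _ ((totalDegree_aeval_le p f hf).trans hp) _ hz'
  simp only [heval, abs_of_nonneg (hp0 _), smul_inv_smul₀ hr.ne', add_sub_cancel] at hbound
  rw [average_ball_eq_average_unitBall _ x hr, ← mul_assoc, mul_assoc C,
    mul_inv_cancel₀ hvol.ne', mul_one]
  exact hbound

theorem reverseHolderWith_of_le_mul_average {n : ℕ} {W : En n → ℝ} {C q : ℝ} (hq : 0 < q)
    (hW : Continuous W) (hW0 : ∀ x, 0 ≤ W x)
    (h : ∀ (x : En n) (r : ℝ), 0 < r → ∀ z ∈ ball x r,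
      W z ≤ C * ((volume (ball x r)).toReal⁻¹ * ∫ y in ball x r, W y)) :
    ReverseHolderWith n q W C := by
  have hWq : Continuous fun y => W y ^ q := hW.rpow_const fun _ => .inr hq.le
  refine ⟨hW0, hW.locallyIntegrable, hWq.locallyIntegrable, fun x r hr => ?_⟩
  set M := C * ((volume (ball x r)).toReal⁻¹ * ∫ y in ball x r, W y)
  have hM : 0 ≤ M := (hW0 x).trans (h x r hr x (mem_ball_self hr))
  have hvol : 0 < (volume (ball x r)).toReal :=
    ENNReal.toReal_pos (measure_ball_pos _ _ hr).ne' measure_ball_lt_top.ne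
  have hint : ∫ y in ball x r, W y ^ q ≤ (volume (ball x r)).toReal * M ^ q := by
    calc ∫ y in ball x r, W y ^ q ≤ ∫ _ in ball x r, M ^ q := by
          refine setIntegral_mono_on ?_ (integrableOn_const measure_ball_lt_top.ne)
            measurableSet_ball fun y hy => Real.rpow_le_rpow (hW0 y) (h x r hr y hy) hq.le
          exact (hWq.locallyIntegrable.integrableOn_isCompact
            (isCompact_closedBall x r)).mono_set ball_subset_closedBall
      _ = (volume (ball x r)).toReal * M ^ q := by
          rw [setIntegral_const, smul_eq_mul, Measure.real]
  have hint0 : 0 ≤ ∫ y in ball x r, W y ^ q :=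
    integral_nonneg fun y => Real.rpow_nonneg (hW0 y) q
  calc ((volume (ball x r)).toReal⁻¹ * ∫ y in ball x r, W y ^ q) ^ q⁻¹
      ≤ (M ^ q) ^ q⁻¹ := by
        refine Real.rpow_le_rpow (by positivity) ?_ (by positivity)
        rwa [inv_mul_le_iff₀ hvol]
    _ = M := Real.rpow_rpow_inv hM hq.ne'

/-- A nonnegative polynomial `V` satisfies `max_B V ≤ C ⨍_B V` with `C` depending only
on `n` and the degree, and hence lies in `B_q` for every `q ∈ (1,∞)` uniformly. -/
theorem statement17 (n : ℕ) (hn : 1 ≤ n) (d : ℕ) :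
    ∃ C : ℝ, 0 < C ∧
      ∀ p : MvPolynomial (Fin n) ℝ, p.totalDegree ≤ d →
        (∀ x : En n, 0 ≤ MvPolynomial.eval (fun i => x i) p) →
        ((∀ (x : En n) (r : ℝ), 0 < r → ∀ z ∈ ball x r,
            MvPolynomial.eval (fun i => z i) p
              ≤ C * ((volume (ball x r)).toReal⁻¹ *
                  ∫ y in ball x r, MvPolynomial.eval (fun i => y i) p)) ∧
          ∀ q : ℝ, 1 < q →
            ReverseHolderWith n q (fun x : En n => MvPolynomial.eval (fun i => x i) p) C) := by
  obtain ⟨C, hC, h⟩ := exists_eval_le_mul_average n d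
  exact ⟨C, hC, fun p hp hp0 => ⟨h p hp hp0, fun q hq =>
    reverseHolderWith_of_le_mul_average (one_pos.trans hq) (continuous_eval_coords p) hp0
      (h p hp hp0)⟩⟩
end
end

section
/- Let n ≥ 3 and let V ∈ B_q(ℝⁿ) for some q > n/2, with V not identically zero. Then there is a constant C > 0, depending only on n and V, such that for every f ∈ BMO_𝓛(ℝⁿ), every x ∈ ℝⁿ and every r > 0: if r < ρ(x) then |f_{B(x,r)}| ≤ C (1 + log(ρ(x)/r)) ‖f‖_{BMO_𝓛}, and if r ≥ ρ(x) then |f_{B(x,r)}| ≤ C ‖f‖_{BMO_𝓛}, where f_{B(x,r)} denotes the average of f over the ball B(x,r). -/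
open MeasureTheory Metric Set
open RealInnerProductSpace

noncomputable section

/-- `BMOLBound n V f C` : `f` satisfies the defining inequalities of `BMO_𝓛(ℝⁿ)` with
constant `C`. -/
def BMOLBound (n : ℕ) (V : En n → ℝ) (f : En n → ℝ) (C : ℝ) : Prop :=
  (∀ (x : En n) (r : ℝ), 0 < r →
      (∫ y in ball x r,
          |f y - (volume (ball x r)).toReal⁻¹ * ∫ z in ball x r, f z|)
        ≤ C * (volume (ball x r)).toReal) ∧
  (∀ (x : En n) (r : ℝ), criticalRadius n V x ≤ r →
      (∫ y in ball x r, |f y|) ≤ C * (volume (ball x r)).toReal)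

theorem volume_ball_toReal_pos {n : ℕ} (x : En n) {r : ℝ} (hr : 0 < r) :
    0 < (volume (ball x r)).toReal :=
  ENNReal.toReal_pos (measure_ball_pos volume x hr).ne' measure_ball_lt_top.ne

theorem volume_ball_two_mul_toReal {n : ℕ} (x : En n) (r : ℝ) :
    (volume (ball x (2 * r))).toReal = 2 ^ n * (volume (ball x r)).toReal := by
  rw [Measure.addHaar_ball_mul_of_pos volume x (by norm_num : (0 : ℝ) < 2),
    ← Measure.addHaar_ball_center volume x r, ENNReal.toReal_mul,
    ENNReal.toReal_ofReal (by positivity)]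
  simp

theorem abs_average_ball_le {n : ℕ} {f : En n → ℝ} {M : ℝ} {x : En n} {r : ℝ} (hr : 0 < r)
    (h : ∫ y in ball x r, |f y| ≤ M * (volume (ball x r)).toReal) :
    |(volume (ball x r)).toReal⁻¹ * ∫ y in ball x r, f y| ≤ M := by
  have hv := volume_ball_toReal_pos x hr
  rw [abs_mul, abs_of_pos (inv_pos.2 hv), inv_mul_le_iff₀ hv, mul_comm]
  exact abs_integral_le_integral_abs.trans h

/-- Averages over a ball and its double differ by at most `2 ^ n` times the mean oscillation
over the double. -/
theorem abs_average_ball_sub_average_ball_two_mul_le {n : ℕ} {f : En n → ℝ} {M : ℝ}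
    (hf : LocallyIntegrable f volume) {x : En n} {r : ℝ} (hr : 0 < r)
    (h : ∫ y in ball x (2 * r),
        |f y - (volume (ball x (2 * r))).toReal⁻¹ * ∫ z in ball x (2 * r), f z|
      ≤ M * (volume (ball x (2 * r))).toReal) :
    |(volume (ball x r)).toReal⁻¹ * (∫ y in ball x r, f y) -
      (volume (ball x (2 * r))).toReal⁻¹ * ∫ y in ball x (2 * r), f y| ≤ 2 ^ n * M := by
  have hv := volume_ball_toReal_pos x hr
  set c := (volume (ball x (2 * r))).toReal⁻¹ * ∫ y in ball x (2 * r), f y with hc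
  have hfc : LocallyIntegrable (fun y => f y - c) volume := hf.sub (locallyIntegrable_const c)
  have havg : (volume (ball x r)).toReal⁻¹ * (∫ y in ball x r, f y) - c =
      (volume (ball x r)).toReal⁻¹ * ∫ y in ball x r, (f y - c) := by
    have hconst : IntegrableOn (fun _ : En n => c) (ball x r) volume :=
      integrableOn_const measure_ball_lt_top.ne
    rw [integral_sub (integrableOn_ball_of_locallyIntegrable hf x r) hconst, setIntegral_const,
      Measure.real, smul_eq_mul, mul_sub, inv_mul_cancel_left₀ hv.ne']
  rw [havg]
  refine abs_average_ball_le hr ?_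
  calc ∫ y in ball x r, |f y - c| ≤ ∫ y in ball x (2 * r), |f y - c| :=
        setIntegral_mono_set (integrableOn_ball_of_locallyIntegrable hfc x (2 * r)).abs
          (Filter.Eventually.of_forall fun _ => abs_nonneg _)
          (ball_subset_ball (by linarith)).eventuallyLE
    _ ≤ M * (volume (ball x (2 * r))).toReal := h
    _ = 2 ^ n * M * (volume (ball x r)).toReal := by
        rw [volume_ball_two_mul_toReal]; ring

theorem BMOLBound.abs_average_ball_le_of_criticalRadius_le_two_pow_mul {n : ℕ} {V f : En n → ℝ}
    {M : ℝ} (hf : LocallyIntegrable f volume) (h : BMOLBound n V f M) (x : En n) (k : ℕ) {r : ℝ}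
    (hr : 0 < r) (hk : criticalRadius n V x ≤ 2 ^ k * r) :
    |(volume (ball x r)).toReal⁻¹ * ∫ y in ball x r, f y| ≤ (1 + k * 2 ^ n) * M := by
  induction k generalizing r with
  | zero => simpa using abs_average_ball_le hr (h.2 x r (by simpa using hk))
  | succ k ih =>
    have hdouble := ih (r := 2 * r) (by positivity) (by rwa [← mul_assoc, ← pow_succ])
    have hdiff := abs_average_ball_sub_average_ball_two_mul_le hf hr
      (h.1 x (2 * r) (by positivity))
    have htri := abs_sub_abs_le_abs_sub
      ((volume (ball x r)).toReal⁻¹ * ∫ y in ball x r, f y)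
      ((volume (ball x (2 * r))).toReal⁻¹ * ∫ y in ball x (2 * r), f y)
    push_cast
    linarith

/-- The number of doublings needed to pass from scale `r` to scale `R`. -/
theorem exists_nat_le_two_pow_mul {r R : ℝ} (hr : 0 < r) (hrR : r < R) :
    ∃ k : ℕ, R ≤ 2 ^ k * r ∧ (k : ℝ) ≤ 1 + 2 * Real.log (R / r) := by
  have hquot : 1 < R / r := (one_lt_div hr).2 hrR
  have hlog : 0 < Real.log (R / r) := Real.log_pos hquot
  have hlogb : 0 < Real.logb 2 (R / r) := Real.logb_pos one_lt_two hquot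
  refine ⟨⌈Real.logb 2 (R / r)⌉₊, ?_, ?_⟩
  · rw [← div_le_iff₀ hr, ← Real.rpow_natCast,
      ← Real.logb_le_iff_le_rpow one_lt_two (by positivity)]
    exact Nat.le_ceil _
  · have hle : Real.logb 2 (R / r) ≤ 2 * Real.log (R / r) := by
      rw [Real.logb, div_le_iff₀ (Real.log_pos one_lt_two)]
      nlinarith [Real.log_two_gt_d9]
    linarith [Nat.ceil_lt_add_one hlogb.le]

/-- Bounds on the averages of a `BMO_𝓛` function over balls, with a logarithmic factor
below the critical radius. -/
theorem statement18 (n : ℕ) (hn : 3 ≤ n) (q : ℝ) (hq : (n : ℝ) / 2 < q)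
    (V : En n → ℝ) (hV : ReverseHolder n q V)
    (hV0 : ¬ (∀ᵐ x ∂(volume : Measure (En n)), V x = 0)) :
    ∃ C : ℝ, 0 < C ∧
      ∀ (f : En n → ℝ) (M : ℝ), 0 ≤ M →
        LocallyIntegrable f volume → BMOLBound n V f M →
        ∀ (x : En n) (r : ℝ), 0 < r →
          (r < criticalRadius n V x →
            |(volume (ball x r)).toReal⁻¹ * ∫ y in ball x r, f y|
              ≤ C * (1 + Real.log (criticalRadius n V x / r)) * M) ∧
          (criticalRadius n V x ≤ r →
            |(volume (ball x r)).toReal⁻¹ * ∫ y in ball x r, f y| ≤ C * M) := by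
  refine ⟨1 + 2 * 2 ^ n, by positivity, fun f M hM hf h x r hr => ⟨fun hlt => ?_, fun hle => ?_⟩⟩
  · obtain ⟨k, hk, hk'⟩ := exists_nat_le_two_pow_mul hr hlt
    have hlog : 0 < Real.log (criticalRadius n V x / r) := Real.log_pos ((one_lt_div hr).2 hlt)
    refine (h.abs_average_ball_le_of_criticalRadius_le_two_pow_mul hf x k hr hk).trans
      (mul_le_mul_of_nonneg_right ?_ hM)
    have hpow : (0 : ℝ) < 2 ^ n := by positivity
    nlinarith [mul_le_mul_of_nonneg_right hk' hpow.le]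
  · refine (abs_average_ball_le hr (h.2 x r hle)).trans (le_mul_of_one_le_left hM ?_)
    linarith [show (0 : ℝ) < 2 ^ n by positivity]
end
end
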